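/- Let x ∈ Ω be an arbitrary point, σ a needle with tip at x, and ξ = {v_n} an arbitrary needle sequence for (x,σ). Then for every finite cone V with vertex at x, lim_{n→∞} ∫_{V∩Ω} |∇v_n(y)|² dy = ∞. -/

import Mathlib

open MeasureTheory Filter Topology Set
open scoped RealInnerProductSpace ENNReal NNReal

noncomputable section

/-- `Euc m` is the Euclidean space `ℝ^m`. -/
abbrev Euc (m : ℕ) := EuclideanSpace ℝ (Fin m)

/-- The `i`-th (classical) partial derivative of a complex-valued function on `ℝ^m`. -/
def pd {m : ℕ} (u : Euc m → ℂ) (y : Euc m) (i : Fin m) : ℂ :=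
  fderiv ℝ u y (EuclideanSpace.single i 1)

/-- The (bilinear, non-Hermitian) dot product `∇u · ∇v` of the gradients. -/
def gradDot {m : ℕ} (u v : Euc m → ℂ) (y : Euc m) : ℂ :=
  ∑ i, pd u y i * pd v y i

/-- `|∇u(y)|²`. -/
def gradNormSq {m : ℕ} (u : Euc m → ℂ) (y : Euc m) : ℝ :=
  ∑ i, ‖pd u y i‖ ^ 2

/-- The Laplacian `Δu`. -/
def lap {m : ℕ} (u : Euc m → ℂ) (y : Euc m) : ℂ :=
  ∑ i, fderiv ℝ (fun z => pd u z i) y (EuclideanSpace.single i 1)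

/-- `u` solves the Helmholtz equation `Δu + k²u = 0` on `U`. -/
def IsHelmholtzOn {m : ℕ} (k : ℝ) (U : Set (Euc m)) (u : Euc m → ℂ) : Prop :=
  ∀ y ∈ U, lap u y + (k : ℂ) ^ 2 * u y = 0

/-- Membership in `H¹(U)` (classical-derivative formulation: differentiable on `U`
with `u` and `∇u` square integrable over `U`). -/
def MemH1 {m : ℕ} (U : Set (Euc m)) (u : Euc m → ℂ) : Prop :=
  DifferentiableOn ℝ u U ∧ IntegrableOn (fun y => ‖u y‖ ^ 2) U volume ∧
    IntegrableOn (fun y => gradNormSq u y) U volume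

/-- `U` has Lipschitz boundary: near each boundary point, `U` is the region lying (in some
unit direction `e`) above the graph of a Lipschitz function of the orthogonal component. -/
def HasLipschitzBoundary {m : ℕ} (U : Set (Euc m)) : Prop :=
  ∀ x ∈ frontier U, ∃ r > (0 : ℝ), ∃ e : Euc m, ‖e‖ = 1 ∧
    ∃ (φ : Euc m → ℝ) (L : ℝ≥0), LipschitzWith L φ ∧
      ∀ y ∈ Metric.ball x r, (y ∈ U ↔ φ (y - ⟪y, e⟫ • e) < ⟪y, e⟫)

/-- `U` has `C²` boundary: as above but with a `C²` graph function. -/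
def HasC2Boundary {m : ℕ} (U : Set (Euc m)) : Prop :=
  ∀ x ∈ frontier U, ∃ r > (0 : ℝ), ∃ e : Euc m, ‖e‖ = 1 ∧
    ∃ φ : Euc m → ℝ, ContDiff ℝ 2 φ ∧
      ∀ y ∈ Metric.ball x r, (y ∈ U ↔ φ (y - ⟪y, e⟫ • e) < ⟪y, e⟫)

/-- Surface measure on `∂U`: the `(m-1)`-dimensional Hausdorff measure restricted to `∂U`. -/
def surfMeasure {m : ℕ} (U : Set (Euc m)) : Measure (Euc m) :=
  (μH[(m - 1 : ℝ)]).restrict (frontier U)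

/-- `G` is a fundamental solution of the Helmholtz operator `Δ + k²` in `ℝ^m`:
it solves the Helmholtz equation away from the origin, is locally integrable, and
satisfies `∫ G (Δφ + k²φ) = -φ(0)` for all test functions `φ`. -/
def IsFundSol {m : ℕ} (k : ℝ) (G : Euc m → ℂ) : Prop :=
  IsHelmholtzOn k ({(0 : Euc m)}ᶜ) G ∧ LocallyIntegrable G volume ∧
    ∀ φ : Euc m → ℂ, ContDiff ℝ (⊤ : ℕ∞) φ → HasCompactSupport φ →
      ∫ y, G y * (lap φ y + (k : ℂ) ^ 2 * φ y) = -φ 0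

/-- A needle with tip at `x`: an injective piecewise-linear curve `σ : [0,1] → Ω̄` with
`σ(0) ∈ ∂Ω`, `σ(1) = x` and `σ(t) ∈ Ω` for `t ∈ (0,1)`. -/
def IsNeedle {m : ℕ} (Ω : Set (Euc m)) (x : Euc m) (σ : ℝ → Euc m) : Prop :=
  σ 0 ∈ frontier Ω ∧ σ 1 = x ∧ (∀ t ∈ Set.Ioo (0 : ℝ) 1, σ t ∈ Ω) ∧
    Set.InjOn σ (Set.Icc 0 1) ∧
    ∃ (M : ℕ) (t : Fin (M + 1) → ℝ), StrictMono t ∧ t 0 = 0 ∧ t (Fin.last M) = 1 ∧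
      ∀ (i : Fin M), ∀ s ∈ Set.Icc (t i.castSucc) (t i.succ),
        σ s = σ (t i.castSucc) +
          ((s - t i.castSucc) / (t i.succ - t i.castSucc)) •
            (σ (t i.succ) - σ (t i.castSucc))

/-- A needle sequence for `(x, σ)`: a sequence of `H¹(Ω)` solutions of the Helmholtz
equation converging to `G_k(· - x)` in `H¹`-norm on each compact subset of `Ω ∖ σ([0,1])`. -/
def IsNeedleSeq {m : ℕ} (Ω : Set (Euc m)) (k : ℝ) (G : Euc m → ℂ) (x : Euc m)
    (σ : ℝ → Euc m) (v : ℕ → Euc m → ℂ) : Prop :=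
  (∀ n, MemH1 Ω (v n) ∧ IsHelmholtzOn k Ω (v n)) ∧
    ∀ K : Set (Euc m), IsCompact K → K ⊆ Ω \ (σ '' Set.Icc 0 1) →
      Tendsto (fun n =>
        Real.sqrt (∫ y in K, ‖v n y - G (y - x)‖ ^ 2) +
          Real.sqrt (∫ y in K, gradNormSq (fun z => v n z - G (z - x)) y))
        atTop (𝓝 0)

/-- `K` is a trace-inequality constant for `W`:
`∫_{∂W} |u|² dS ≤ K (ε ∫_W |∇u|² + ε⁻¹ ∫_W |u|²)` for all `u ∈ H¹(W)`, `ε ∈ (0,1)`. -/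
def TraceConst {m : ℕ} (W : Set (Euc m)) (K : ℝ) : Prop :=
  0 < K ∧ ∀ u : Euc m → ℂ, MemH1 W u → ∀ ε ∈ Set.Ioo (0 : ℝ) 1,
    (∫ y, ‖u y‖ ^ 2 ∂surfMeasure W)
      ≤ K * (ε * (∫ y in W, gradNormSq u y) + ε⁻¹ * ∫ y in W, ‖u y‖ ^ 2)

/-- `C` is a mean-value Poincaré constant for `U`:
`∫_U |v - v_A|² ≤ C² (1 + |U|^{1/2}/|A|^{1/2})² ∫_U |∇v|²`. -/
def MeanPoincareConst {m : ℕ} (U : Set (Euc m)) (C : ℝ) : Prop :=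
  0 < C ∧ ∀ v : Euc m → ℂ, MemH1 U v → ∀ A : Set (Euc m), MeasurableSet A → A ⊆ U →
    0 < volume A →
    (∫ y in U, ‖v y - ((volume A).toReal)⁻¹ • (∫ z in A, v z)‖ ^ 2)
      ≤ C ^ 2 * (1 + Real.sqrt ((volume U).toReal) / Real.sqrt ((volume A).toReal)) ^ 2 *
          ∫ y in U, gradNormSq v y

/-- The finite cone of height `ρ`, axis direction `b` and aperture angle `θ` with vertex `x`. -/
def finiteCone {m : ℕ} (x b : Euc m) (ρ θ : ℝ) : Set (Euc m) :=
  {y | ‖y - x‖ < ρ ∧ ⟪y - x, b⟫ > ‖y - x‖ * ‖b‖ * Real.cos (θ / 2)}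

/-- The full geometric/analytic setting of the paper: a bounded Lipschitz domain `Ω ⊆ ℝ^m`
(`m = 2, 3`), an obstacle `D` with `D̄ ⊆ Ω`, `Ω ∖ D̄` connected, `D` a finite union of
bounded Lipschitz domains `D_j` with pairwise disjoint closures, a unit outward normal field
`ν` on `∂D`, an impedance `λ ∈ L^∞(∂D)` with `Im λ ≥ c > 0` a.e., a wave number `k ≥ 0`
which is not a Dirichlet eigenvalue of `Δ + k²` in `Ω`, and the standard fundamental
solution `G = G_k` of the Helmholtz equation. -/
structure Setting (m : ℕ) where
  Ω : Set (Euc m)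
  D : Set (Euc m)
  N : ℕ
  Dj : Fin N → Set (Euc m)
  ν : Euc m → Euc m
  lam : Euc m → ℂ
  k : ℝ
  G : Euc m → ℂ
  dim_eq : m = 2 ∨ m = 3
  Ω_open : IsOpen Ω
  Ω_conn : IsConnected Ω
  Ω_bdd : Bornology.IsBounded Ω
  Ω_lip : HasLipschitzBoundary Ω
  D_open : IsOpen D
  D_lip : HasLipschitzBoundary D
  D_cl_sub : closure D ⊆ Ω
  ext_conn : IsConnected (Ω \ closure D)
  N_pos : 0 < N
  D_eq : D = ⋃ j, Dj j
  Dj_open : ∀ j, IsOpen (Dj j)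
  Dj_conn : ∀ j, IsConnected (Dj j)
  Dj_bdd : ∀ j, Bornology.IsBounded (Dj j)
  Dj_lip : ∀ j, HasLipschitzBoundary (Dj j)
  Dj_disj : ∀ j l, j ≠ l → closure (Dj j) ∩ closure (Dj l) = ∅
  k_nonneg : 0 ≤ k
  ν_unit : ∀ y ∈ frontier D, ‖ν y‖ = 1
  lam_bdd : ∃ Cb : ℝ, ∀ᵐ y ∂surfMeasure D, ‖lam y‖ ≤ Cb
  lam_im_pos : ∃ c > (0 : ℝ), ∀ᵐ y ∂surfMeasure D, c ≤ (lam y).im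
  G_fund : IsFundSol k G
  not_eigen : ∀ u : Euc m → ℂ, MemH1 Ω u → IsHelmholtzOn k Ω u →
    (∀ᵐ y ∂surfMeasure Ω, u y = 0) → ∀ y ∈ Ω, u y = 0

namespace Setting

variable {m : ℕ}

/-- The exterior domain `Ω ∖ D̄`. -/
def ext (S : Setting m) : Set (Euc m) := S.Ω \ closure S.D

/-- Surface measure on `∂Ω`. -/
def surfΩ (S : Setting m) : Measure (Euc m) := surfMeasure S.Ω

/-- Surface measure on `∂D`. -/
def surfD (S : Setting m) : Measure (Euc m) := surfMeasure S.D

/-- `u` is a weak solution of problem (1.1): `Δu + k²u = 0` in `Ω ∖ D̄`,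
`∂u/∂ν + λu = 0` on `∂D`, `u = f` on `∂Ω` (trace sense), i.e. `u ∈ H¹(Ω ∖ D̄)`, `u = f`
a.e. on `∂Ω` and for every test function `φ ∈ H¹(Ω ∖ D̄)` vanishing on `∂Ω`:
`∫_{∂D} λuφ dS - ∫ ∇u·∇φ + k² ∫ uφ = 0`. -/
def IsSolution (S : Setting m) (f u : Euc m → ℂ) : Prop :=
  MemH1 S.ext u ∧ (∀ᵐ y ∂S.surfΩ, u y = f y) ∧
    ∀ φ : Euc m → ℂ, MemH1 S.ext φ → (∀ᵐ y ∂S.surfΩ, φ y = 0) →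
      (∫ y, S.lam y * u y * φ y ∂S.surfD) - (∫ y in S.ext, gradDot u φ y)
        + (S.k : ℂ) ^ 2 * ∫ y in S.ext, u y * φ y = 0

/-- The pairing `⟨Λ₀ f, f̄⟩` with `f = v|_{∂Ω}`, computed from the solution `v` of the
Helmholtz equation in `Ω` (the conjugate `v̄` being an extension of `f̄`). -/
def pair0 (S : Setting m) (v : Euc m → ℂ) : ℂ :=
  (∫ y in S.Ω, gradDot v (fun z => (starRingEnd ℂ) (v z)) y)
    - (S.k : ℂ) ^ 2 * ∫ y in S.Ω, v y * (starRingEnd ℂ) (v y)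

/-- The pairing `⟨Λ_D f, f̄⟩` with `f = v|_{∂Ω}`, computed from the weak solution `u` of
(1.1) and the extension `v̄` of `f̄`. -/
def pairD (S : Setting m) (u v : Euc m → ℂ) : ℂ :=
  -(∫ y, S.lam y * u y * (starRingEnd ℂ) (v y) ∂S.surfD)
    + (∫ y in S.ext, gradDot u (fun z => (starRingEnd ℂ) (v z)) y)
    - (S.k : ℂ) ^ 2 * ∫ y in S.ext, u y * (starRingEnd ℂ) (v y)

/-- One term `Re ⟨(Λ₀ - Λ_D) f, f̄⟩` of the indicator sequence, where `f = v|_{∂Ω}`,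
`v` solves the Helmholtz equation in `Ω` and `u` is the weak solution of (1.1). -/
def indicatorTerm (S : Setting m) (u v : Euc m → ℂ) : ℝ := (S.pair0 v - S.pairD u v).re

/-- `G_k(· - x)`. -/
def Gx (S : Setting m) (x : Euc m) : Euc m → ℂ := fun y => S.G (y - x)

/-- `w` is the reflected solution of `v` by `D`: the weak solution of
`Δw + k²w = 0` in `Ω ∖ D̄`, `∂w/∂ν + λw = -(∂v/∂ν + λv)` on `∂D`, `w = 0` on `∂Ω`. -/
def IsReflected (S : Setting m) (v w : Euc m → ℂ) : Prop :=
  MemH1 S.ext w ∧ (∀ᵐ y ∂S.surfΩ, w y = 0) ∧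
    ∀ φ : Euc m → ℂ, MemH1 S.ext φ → (∀ᵐ y ∂S.surfΩ, φ y = 0) →
      (∫ y, S.lam y * w y * φ y ∂S.surfD) - (∫ y in S.ext, gradDot w φ y)
        + (S.k : ℂ) ^ 2 * ∫ y in S.ext, w y * φ y
        = -∫ y, (fderiv ℝ v y (S.ν y) + S.lam y * v y) * φ y ∂S.surfD

/-- The value `I(x)` of the indicator function, expressed through the reflected
solution `w = w_x` of `G_k(· - x)` by `D` (formula (2.1)). -/
def indicatorFun (S : Setting m) (x : Euc m) (w : Euc m → ℂ) : ℝ :=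
  (∫ y in S.ext, gradNormSq w y) - S.k ^ 2 * (∫ y in S.ext, ‖w y‖ ^ 2)
    + (∫ y in S.D, gradNormSq (S.Gx x) y) - S.k ^ 2 * (∫ y in S.D, ‖S.Gx x y‖ ^ 2)
    + ∫ y, ((S.lam y).re * (‖S.Gx x y‖ ^ 2 - ‖w y‖ ^ 2)
        - 2 * (S.lam y).im * ((w y * (starRingEnd ℂ) (S.Gx x y)).im)) ∂S.surfD

/-- `‖Re λ‖_{L^∞(∂D)} + ‖Im λ‖_{L^∞(∂D)} ≤ L`. -/
def LamBound (S : Setting m) (L : ℝ) : Prop :=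
  eLpNorm (fun y => (S.lam y).re) ⊤ S.surfD + eLpNorm (fun y => (S.lam y).im) ⊤ S.surfD
    ≤ ENNReal.ofReal L

/-- `λ ∈ C¹(∂D)`: `λ` is the restriction to `∂D` of a `C¹` function. -/
def LamC1 (S : Setting m) : Prop :=
  ∃ Λ : Euc m → ℂ, ContDiff ℝ 1 Λ ∧ ∀ y ∈ frontier S.D, Λ y = S.lam y

end Setting

open scoped ContDiff

/-- A smooth monotone step function, equal to `0` on `(-∞, 1/2]` and to `1` on `[1, ∞)`. -/
def smoothStep (s : ℝ) : ℝ := Real.smoothTransition (2 * s - 1)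

lemma smoothStep_contDiff : ContDiff ℝ ∞ smoothStep :=
  Real.smoothTransition.contDiff.comp (by fun_prop)

lemma smoothStep_monotone : Monotone smoothStep := fun a b hab =>
  Real.smoothTransition.monotone (by linarith)

lemma smoothStep_eq_zero {s : ℝ} (hs : s ≤ 1 / 2) : smoothStep s = 0 :=
  Real.smoothTransition.zero_of_nonpos (by linarith)

lemma smoothStep_eq_one {s : ℝ} (hs : 1 ≤ s) : smoothStep s = 1 :=
  Real.smoothTransition.one_of_one_le (by linarith)

lemma deriv_smoothStep_contDiff : ContDiff ℝ ∞ (deriv smoothStep) :=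
  (contDiff_infty_iff_deriv.1 smoothStep_contDiff).2

lemma smoothStep_hasDerivAt (s : ℝ) : HasDerivAt smoothStep (deriv smoothStep s) s :=
  ((contDiff_infty_iff_deriv.1 smoothStep_contDiff).1 s).hasDerivAt

lemma deriv_smoothStep_eq_zero_of_lt {s : ℝ} (hs : s < 1 / 2) : deriv smoothStep s = 0 := by
  have : smoothStep =ᶠ[𝓝 s] fun _ => 0 := by
    filter_upwards [gt_mem_nhds hs] with u hu using smoothStep_eq_zero hu.le
  simpa using this.deriv_eq

lemma deriv_smoothStep_eq_zero_of_gt {s : ℝ} (hs : 1 < s) : deriv smoothStep s = 0 := by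
  have : smoothStep =ᶠ[𝓝 s] fun _ => 1 := by
    filter_upwards [lt_mem_nhds hs] with u hu using smoothStep_eq_one hu.le
  simpa using this.deriv_eq

lemma deriv_smoothStep_nonneg (s : ℝ) : 0 ≤ deriv smoothStep s :=
  smoothStep_monotone.deriv_nonneg

lemma contDiff_rpow_mul_of_eq_zero {f : ℝ → ℝ} (hf : ContDiff ℝ ∞ f) (a : ℝ) {c : ℝ}
    (hc : 0 < c) (h0 : ∀ s < c, f s = 0) : ContDiff ℝ ∞ (fun s => s ^ a * f s) := by
  rw [contDiff_iff_contDiffAt]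
  intro s
  rcases le_or_gt s 0 with hs | hs
  · have : (fun s => s ^ a * f s) =ᶠ[𝓝 s] fun _ => 0 := by
      filter_upwards [gt_mem_nhds (hs.trans_lt hc)] with u hu
      rw [h0 u hu, mul_zero]
    exact contDiffAt_const.congr_of_eventuallyEq this
  · exact (contDiffAt_id.rpow_const_of_ne hs.ne').mul hf.contDiffAt

/-- The profile (as a function of the squared radius) of the mollifier attached to the
regularized fundamental solution of the Laplacian. -/
def mollProfile (m : ℕ) (s : ℝ) : ℝ := 2 * (s ^ (1 - (m : ℝ) / 2) * deriv smoothStep s)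

lemma mollProfile_contDiff (m : ℕ) : ContDiff ℝ ∞ (mollProfile m) :=
  contDiff_const.mul (contDiff_rpow_mul_of_eq_zero deriv_smoothStep_contDiff _ one_half_pos
    fun _ hs => deriv_smoothStep_eq_zero_of_lt hs)

lemma mollProfile_eq_zero_of_lt (m : ℕ) {s : ℝ} (hs : s < 1 / 2) : mollProfile m s = 0 := by
  simp [mollProfile, deriv_smoothStep_eq_zero_of_lt hs]

lemma mollProfile_eq_zero_of_gt (m : ℕ) {s : ℝ} (hs : 1 < s) : mollProfile m s = 0 := by
  simp [mollProfile, deriv_smoothStep_eq_zero_of_gt hs]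

lemma mollProfile_nonneg (m : ℕ) (s : ℝ) : 0 ≤ mollProfile m s := by
  rcases lt_or_ge s (1 / 2) with hs | hs
  · rw [mollProfile_eq_zero_of_lt m hs]
  · have := deriv_smoothStep_nonneg s
    have : 0 ≤ s := by linarith
    unfold mollProfile; positivity

lemma exists_mollProfile_pos (m : ℕ) : ∃ s : ℝ, 0 < s ∧ 0 < mollProfile m s := by
  obtain ⟨s, hs, h⟩ := exists_deriv_eq_slope smoothStep (a := 1 / 2) (b := 1) (by norm_num)
    smoothStep_contDiff.continuous.continuousOn
    (fun s _ => (smoothStep_hasDerivAt s).differentiableAt.differentiableWithinAt)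
  rw [smoothStep_eq_zero le_rfl, smoothStep_eq_one le_rfl] at h
  have hs0 : 0 < s := by linarith [hs.1]
  refine ⟨s, hs0, ?_⟩
  rw [mollProfile, h]
  positivity

/-- The truncated weight: `s ^ (-m/2)` on `[t², 1/2]`, vanishing for `s ≤ t²/2` and `s ≥ 1`. -/
def radialWeight (m : ℕ) (t s : ℝ) : ℝ :=
  s ^ (-(m : ℝ) / 2) * (smoothStep (s / t ^ 2) - smoothStep s)

lemma smoothStep_sub_eq_zero {t s : ℝ} (ht : 0 < t) (ht1 : t ≤ 1) (hs : s ≤ t ^ 2 / 2) :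
    smoothStep (s / t ^ 2) - smoothStep s = 0 := by
  have : s ≤ 1 / 2 := by nlinarith
  rw [smoothStep_eq_zero this, smoothStep_eq_zero, sub_zero]
  rw [div_le_iff₀ (by positivity)]; linarith

lemma radialWeight_contDiff (m : ℕ) {t : ℝ} (ht : 0 < t) (ht1 : t ≤ 1) :
    ContDiff ℝ ∞ (radialWeight m t) := by
  refine contDiff_rpow_mul_of_eq_zero (c := t ^ 2 / 2) ?_ _ (by positivity)
    fun s hs => smoothStep_sub_eq_zero ht ht1 hs.le
  exact (smoothStep_contDiff.comp (contDiff_id.div_const _)).sub smoothStep_contDiff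

lemma radialWeight_eq_zero_of_le (m : ℕ) {t s : ℝ} (ht : 0 < t) (ht1 : t ≤ 1)
    (hs : s ≤ t ^ 2 / 2) : radialWeight m t s = 0 := by
  rw [radialWeight, smoothStep_sub_eq_zero ht ht1 hs, mul_zero]

lemma radialWeight_eq_zero_of_one_le (m : ℕ) {t s : ℝ} (ht : 0 < t) (ht1 : t ≤ 1)
    (hs : 1 ≤ s) : radialWeight m t s = 0 := by
  have : 1 ≤ s / t ^ 2 := by
    rw [le_div_iff₀ (by positivity)]; nlinarith
  rw [radialWeight, smoothStep_eq_one hs, smoothStep_eq_one this, sub_self, mul_zero]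

lemma radialWeight_eq (m : ℕ) {t s : ℝ} (ht : 0 < t) (hts : t ^ 2 ≤ s) (hs : s ≤ 1 / 2) :
    radialWeight m t s = s ^ (-(m : ℝ) / 2) := by
  have : 1 ≤ s / t ^ 2 := by
    rwa [le_div_iff₀ (by positivity), one_mul]
  rw [radialWeight, smoothStep_eq_one this, smoothStep_eq_zero hs, sub_zero, mul_one]

lemma radialWeight_nonneg (m : ℕ) {t s : ℝ} (ht : 0 < t) (ht1 : t ≤ 1) :
    0 ≤ radialWeight m t s := by
  rcases le_or_gt s 0 with hs | hs
  · rw [radialWeight_eq_zero_of_le m ht ht1 (hs.trans (by positivity))]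
  · have : s ≤ s / t ^ 2 := by
      rw [le_div_iff₀ (by positivity)]
      exact mul_le_of_le_one_right hs.le (pow_le_one₀ ht.le ht1)
    exact mul_nonneg (by positivity) (sub_nonneg.2 (smoothStep_monotone this))

lemma radialWeight_le (m : ℕ) {t s : ℝ} (hs : 0 < s) :
    radialWeight m t s ≤ s ^ (-(m : ℝ) / 2) := by
  have h1 : smoothStep (s / t ^ 2) ≤ 1 := Real.smoothTransition.le_one _
  have h2 : 0 ≤ smoothStep s := Real.smoothTransition.nonneg _
  exact mul_le_of_le_one_right (by positivity) (by linarith)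

/-- The radial Laplace equation satisfied by the truncated weight. -/
lemma radialWeight_ode (m : ℕ) {t : ℝ} (ht : 0 < t) (ht1 : t ≤ 1) (s : ℝ) :
    -2 * s * deriv (radialWeight m t) s - m * radialWeight m t s =
      mollProfile m s - (t ^ m)⁻¹ * mollProfile m (s / t ^ 2) := by
  rcases le_or_gt s 0 with hs | hs
  · have h0 : radialWeight m t =ᶠ[𝓝 s] fun _ => 0 := by
      have : s < t ^ 2 / 2 := hs.trans_lt (by positivity)
      filter_upwards [gt_mem_nhds this] with u hu
      exact radialWeight_eq_zero_of_le m ht ht1 hu.le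
    have hst : s / t ^ 2 ≤ 0 := div_nonpos_of_nonpos_of_nonneg hs (by positivity)
    rw [h0.deriv_eq, h0.eq_of_nhds, mollProfile_eq_zero_of_lt m (by linarith),
      mollProfile_eq_zero_of_lt m (by linarith)]
    simp
  · have hd := (Real.hasDerivAt_rpow_const (p := -(m : ℝ) / 2) (Or.inl hs.ne')).mul
      (((smoothStep_hasDerivAt (s / t ^ 2)).comp s ((hasDerivAt_id s).div_const (t ^ 2))).sub
        (smoothStep_hasDerivAt s))
    have e1 : deriv (radialWeight m t) s = _ := hd.deriv
    rw [e1]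
    have h1 : s ^ (-(m : ℝ) / 2 - 1) = s ^ (-(m : ℝ) / 2) / s := by
      rw [Real.rpow_sub hs, Real.rpow_one]
    have h2 : s ^ (1 - (m : ℝ) / 2) = s * s ^ (-(m : ℝ) / 2) := by
      rw [sub_eq_add_neg, Real.rpow_add hs, Real.rpow_one, neg_div]
    have h3 : (s / t ^ 2) ^ (1 - (m : ℝ) / 2) =
        s * s ^ (-(m : ℝ) / 2) * t ^ m / t ^ 2 := by
      rw [Real.div_rpow hs.le (by positivity), h2, ← Real.rpow_natCast t 2, ← Real.rpow_mul ht.le,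
        ← Real.rpow_natCast t m]
      have : ((2 : ℕ) : ℝ) * (1 - (m : ℝ) / 2) = ((2 : ℕ) : ℝ) - m := by push_cast; ring
      rw [this, Real.rpow_sub ht]
      have := Real.rpow_pos_of_pos ht m
      field_simp
    simp only [radialWeight, mollProfile, h1, h2, h3, Function.comp, id, Pi.sub_apply]
    field_simp
    ring

/-- The profile of the truncated fundamental solution of the Laplacian. -/
def fundProfile (m : ℕ) (t s : ℝ) : ℝ := (1 / 2) * ∫ u in s..1, radialWeight m t u

lemma fundProfile_hasDerivAt (m : ℕ) {t : ℝ} (ht : 0 < t) (ht1 : t ≤ 1) (s : ℝ) :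
    HasDerivAt (fundProfile m t) (-(1 / 2) * radialWeight m t s) s := by
  have hc := (radialWeight_contDiff m ht ht1).continuous
  have := (intervalIntegral.integral_hasDerivAt_left (hc.intervalIntegrable s 1)
    hc.stronglyMeasurable.stronglyMeasurableAtFilter hc.continuousAt).const_mul (1 / 2 : ℝ)
  exact this.congr_deriv (by ring)

lemma fundProfile_contDiff (m : ℕ) {t : ℝ} (ht : 0 < t) (ht1 : t ≤ 1) :
    ContDiff ℝ ∞ (fundProfile m t) := by
  rw [contDiff_infty_iff_deriv]
  refine ⟨fun s => (fundProfile_hasDerivAt m ht ht1 s).differentiableAt, ?_⟩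
  rw [funext fun s => (fundProfile_hasDerivAt m ht ht1 s).deriv]
  exact contDiff_const.mul (radialWeight_contDiff m ht ht1)

lemma fundProfile_eq_zero (m : ℕ) {t s : ℝ} (ht : 0 < t) (ht1 : t ≤ 1) (hs : 1 ≤ s) :
    fundProfile m t s = 0 := by
  rw [fundProfile, intervalIntegral.integral_symm, intervalIntegral.integral_congr (g := fun _ => 0)]
  · simp
  · intro u hu
    rw [uIcc_of_le hs] at hu
    exact radialWeight_eq_zero_of_one_le m ht ht1 hu.1

lemma fundProfile_nonneg (m : ℕ) {t s : ℝ} (ht : 0 < t) (ht1 : t ≤ 1) :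
    0 ≤ fundProfile m t s := by
  rcases le_or_gt s 1 with hs | hs
  · exact mul_nonneg (by norm_num)
      (intervalIntegral.integral_nonneg hs fun u _ => radialWeight_nonneg m ht ht1)
  · rw [fundProfile_eq_zero m ht ht1 hs.le]

lemma fundProfile_le (m : ℕ) (hm : 2 ≤ m) {t s : ℝ} (ht : 0 < t) (ht1 : t ≤ 1) (hs : 0 < s) :
    fundProfile m t s ≤ 4 * s ^ (-((m : ℝ) - 7 / 4) / 2) := by
  rcases le_or_gt s 1 with hs1 | hs1
  · have hm' : (2 : ℝ) ≤ m := by exact_mod_cast hm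
    have hc := (radialWeight_contDiff m ht ht1).continuous
    have h0 : (0 : ℝ) ∉ uIcc s 1 := by
      rw [uIcc_of_le hs1]; exact fun h => absurd h.1 (by linarith)
    have hp : -((m : ℝ) - 7 / 4) / 2 - 1 ≠ -1 := by intro h; linarith
    have h1 : ∫ u in s..1, radialWeight m t u ≤
        ∫ u in s..1, u ^ (-((m : ℝ) - 7 / 4) / 2 - 1) := by
      refine intervalIntegral.integral_mono_on hs1 (hc.intervalIntegrable _ _)
        (intervalIntegral.intervalIntegrable_rpow (Or.inr h0)) fun u hu => ?_
      have hu0 : 0 < u := hs.trans_le hu.1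
      exact (radialWeight_le m hu0).trans
        (Real.rpow_le_rpow_of_exponent_ge hu0 hu.2 (by linarith))
    rw [integral_rpow (Or.inr ⟨hp, h0⟩)] at h1
    have h2 : 0 < s ^ (-((m : ℝ) - 7 / 4) / 2) := by positivity
    set X := s ^ (-((m : ℝ) - 7 / 4) / 2)
    rw [sub_add_cancel, Real.one_rpow] at h1
    have h3 : (1 - X) / (-((m : ℝ) - 7 / 4) / 2) ≤ 8 * X := by
      rw [div_le_iff_of_neg (by linarith)]
      nlinarith
    unfold fundProfile
    linarith
  · rw [fundProfile_eq_zero m ht ht1 hs1.le]; positivity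

lemma pd_ofReal {m : ℕ} {A : Euc m → ℝ} {A' : Euc m →L[ℝ] ℝ} {y : Euc m}
    (h : HasFDerivAt A A' y) (i : Fin m) :
    pd (fun z => (A z : ℂ)) y i = (A' (EuclideanSpace.single i 1) : ℝ) := by
  have := (Complex.ofRealCLM.hasFDerivAt (x := A y)).comp y h
  rw [pd, show fderiv ℝ (fun z => (A z : ℂ)) y = Complex.ofRealCLM.comp A' from this.fderiv]
  rfl

lemma hasFDerivAt_radial {m : ℕ} {q : ℝ → ℝ} {q' : ℝ} (y₀ y : Euc m)
    (hq : HasDerivAt q q' (‖y - y₀‖ ^ 2)) :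
    HasFDerivAt (fun z : Euc m => q (‖z - y₀‖ ^ 2)) ((2 * q') • innerSL ℝ (y - y₀)) y := by
  have h1 : HasFDerivAt (fun z : Euc m => ‖z - y₀‖ ^ 2) _ y :=
    ((hasFDerivAt_id y).sub_const y₀).norm_sq
  have h2 := hq.comp_hasFDerivAt y h1
  refine h2.congr_fderiv ?_
  ext h
  simp
  ring

lemma hasFDerivAt_affine {m : ℕ} (c : ℝ) (e y₀ y : Euc m) :
    HasFDerivAt (fun z : Euc m => c + ⟪e, z - y₀⟫) (innerSL ℝ e) y := by
  have := ((innerSL ℝ e).hasFDerivAt (x := y - y₀)).comp y ((hasFDerivAt_id y).sub_const y₀)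
  exact (this.const_add c).congr_fderiv (by ext; simp)

/-- The Laplacian of an affine function times a radial function. -/
lemma lap_affine_mul_radial {m : ℕ} {q q₁ q₂ : ℝ → ℝ} (hq : ∀ s, HasDerivAt q (q₁ s) s)
    (hq₁ : ∀ s, HasDerivAt q₁ (q₂ s) s) (c : ℝ) (e y₀ y : Euc m) :
    lap (fun z => (((c + ⟪e, z - y₀⟫) * q (‖z - y₀‖ ^ 2) : ℝ) : ℂ)) y =
      (((c + ⟪e, y - y₀⟫) * (4 * ‖y - y₀‖ ^ 2 * q₂ (‖y - y₀‖ ^ 2) + 2 * m * q₁ (‖y - y₀‖ ^ 2)) +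
        4 * ⟪e, y - y₀⟫ * q₁ (‖y - y₀‖ ^ 2) : ℝ) : ℂ) := by
  have hpd : ∀ i : Fin m,
      (fun z => pd (fun z => (((c + ⟪e, z - y₀⟫) * q (‖z - y₀‖ ^ 2) : ℝ) : ℂ)) z i) =
      fun z => ((e i * q (‖z - y₀‖ ^ 2) +
        2 * ((c + ⟪e, z - y₀⟫) * q₁ (‖z - y₀‖ ^ 2) * (z - y₀) i) : ℝ) : ℂ) := by
    intro i
    funext z
    refine (pd_ofReal ((hasFDerivAt_affine c e y₀ z).mul
      (hasFDerivAt_radial y₀ z (hq _))) i).trans ?_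
    congr 1
    simp [EuclideanSpace.inner_single_right]
    ring
  have hcoord : ∀ i : Fin m, HasFDerivAt (fun z : Euc m => (z - y₀) i)
      (EuclideanSpace.proj i : Euc m →L[ℝ] ℝ) y := fun i => by
    have := ((EuclideanSpace.proj i : Euc m →L[ℝ] ℝ).hasFDerivAt (x := y - y₀)).comp y
      ((hasFDerivAt_id y).sub_const y₀)
    exact this.congr_fderiv (by ext; simp)
  have hsecond : ∀ i : Fin m,
      fderiv ℝ (fun z => pd (fun z => (((c + ⟪e, z - y₀⟫) * q (‖z - y₀‖ ^ 2) : ℝ) : ℂ)) z i) y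
        (EuclideanSpace.single i 1) =
      ((4 * q₁ (‖y - y₀‖ ^ 2) * (e i * (y - y₀) i) +
        4 * (c + ⟪e, y - y₀⟫) * q₂ (‖y - y₀‖ ^ 2) * (y - y₀) i ^ 2 +
        2 * (c + ⟪e, y - y₀⟫) * q₁ (‖y - y₀‖ ^ 2) : ℝ) : ℂ) := by
    intro i
    rw [hpd i]
    have h1 := ((hasFDerivAt_radial y₀ y (hq _)).const_mul (e i)).add
      ((((hasFDerivAt_affine c e y₀ y).mul (hasFDerivAt_radial y₀ y (hq₁ _))).mul
        (hcoord i)).const_mul 2)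
    have h2 := pd_ofReal h1 i
    rw [pd] at h2
    refine h2.trans ?_
    congr 1
    simp [EuclideanSpace.inner_single_right]
    ring
  rw [lap, Finset.sum_congr rfl fun i _ => hsecond i, ← Complex.ofReal_sum]
  congr 1
  have hinner : ∑ i, e i * (y - y₀) i = ⟪e, y - y₀⟫ := by
    simp [PiLp.inner_apply, mul_comm]
  have hnorm : ∑ i, (y - y₀) i ^ 2 = ‖y - y₀‖ ^ 2 := by
    rw [EuclideanSpace.norm_sq_eq]; simp
  rw [Finset.sum_add_distrib, Finset.sum_add_distrib, ← Finset.mul_sum, ← Finset.mul_sum,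
    hinner, hnorm]
  simp
  ring

lemma contDiff_affine_mul_radial {m : ℕ} {q : ℝ → ℝ} (hq : ContDiff ℝ ∞ q) (c : ℝ)
    (e y₀ : Euc m) :
    ContDiff ℝ ∞ (fun z : Euc m => (((c + ⟪e, z - y₀⟫) * q (‖z - y₀‖ ^ 2) : ℝ) : ℂ)) := by
  refine Complex.ofRealCLM.contDiff.comp (ContDiff.mul ?_ (hq.comp ?_))
  · exact contDiff_const.add (contDiff_const.inner ℝ (contDiff_id.sub contDiff_const))
  · exact (contDiff_id.sub contDiff_const).norm_sq ℝ

lemma hasCompactSupport_affine_mul_radial {m : ℕ} {q : ℝ → ℝ} (hq : ∀ s, 1 ≤ s → q s = 0)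
    (c : ℝ) (e y₀ : Euc m) :
    HasCompactSupport (fun z : Euc m => (((c + ⟪e, z - y₀⟫) * q (‖z - y₀‖ ^ 2) : ℝ) : ℂ)) := by
  refine HasCompactSupport.of_support_subset_isCompact (isCompact_closedBall y₀ 1) fun z hz => ?_
  by_contra h
  rw [mem_closedBall_iff_norm, not_le] at h
  apply hz
  simp only
  rw [hq _ (by nlinarith), mul_zero, Complex.ofReal_zero]

/-- Testing a fundamental solution with the truncated fundamental solution of the Laplacian. -/
lemma IsFundSol.integral_mul_fundProfile {m : ℕ} {k : ℝ} {G : Euc m → ℂ} (hG : IsFundSol k G)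
    {t : ℝ} (ht : 0 < t) (ht1 : t ≤ 1) (y₀ : Euc m) :
    ∫ y, G y * ((mollProfile m (‖y - y₀‖ ^ 2) -
        (t ^ m)⁻¹ * mollProfile m (‖y - y₀‖ ^ 2 / t ^ 2) +
        k ^ 2 * fundProfile m t (‖y - y₀‖ ^ 2) : ℝ) : ℂ) =
      -(fundProfile m t (‖y₀‖ ^ 2) : ℂ) := by
  have hw : ∀ s, HasDerivAt (fun s => -(1 / 2) * radialWeight m t s)
      (-(1 / 2) * deriv (radialWeight m t) s) s := fun s =>
    ((contDiff_infty_iff_deriv.1 (radialWeight_contDiff m ht ht1)).1 s).hasDerivAt.const_mul _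
  have h := hG.2.2 _ (contDiff_affine_mul_radial (fundProfile_contDiff m ht ht1) 1 0 y₀)
    (hasCompactSupport_affine_mul_radial (fun s => fundProfile_eq_zero m ht ht1) 1 0 y₀)
  simp only [inner_zero_left, add_zero, one_mul, zero_sub, norm_neg] at h
  rw [← h]
  refine integral_congr_ae (Eventually.of_forall fun y => ?_)
  have hl := lap_affine_mul_radial (fundProfile_hasDerivAt m ht ht1) hw 1 0 y₀ y
  simp only [inner_zero_left, add_zero, one_mul, mul_zero, zero_mul] at hl
  simp only [hl, ← radialWeight_ode m ht ht1]
  push_cast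
  ring

/-- Testing a fundamental solution with a derivative of the truncated fundamental solution of
the Laplacian. -/
lemma IsFundSol.integral_mul_radialWeight {m : ℕ} {k : ℝ} {G : Euc m → ℂ} (hG : IsFundSol k G)
    {t : ℝ} (ht : 0 < t) (ht1 : t ≤ 1) (e y₀ : Euc m) :
    ∫ y, G y * ((2 * ⟪e, y - y₀⟫ * (deriv (mollProfile m) (‖y - y₀‖ ^ 2) -
        (t ^ m)⁻¹ * (t ^ 2)⁻¹ * deriv (mollProfile m) (‖y - y₀‖ ^ 2 / t ^ 2)) -
        k ^ 2 * (⟪e, y - y₀⟫ * radialWeight m t (‖y - y₀‖ ^ 2)) : ℝ) : ℂ) =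
      -((⟪e, y₀⟫ * radialWeight m t (‖y₀‖ ^ 2) : ℝ) : ℂ) := by
  have hw := radialWeight_contDiff m ht ht1
  have hw1 : ∀ s, HasDerivAt (radialWeight m t) (deriv (radialWeight m t) s) s := fun s =>
    ((contDiff_infty_iff_deriv.1 hw).1 s).hasDerivAt
  have hw2 : ∀ s, HasDerivAt (deriv (radialWeight m t)) (deriv (deriv (radialWeight m t)) s) s :=
    fun s => ((contDiff_infty_iff_deriv.1 (contDiff_infty_iff_deriv.1 hw).2).1 s).hasDerivAt
  have hp : ∀ s, HasDerivAt (mollProfile m) (deriv (mollProfile m) s) s := fun s =>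
    ((contDiff_infty_iff_deriv.1 (mollProfile_contDiff m)).1 s).hasDerivAt
  have hode : ∀ s, -2 * s * deriv (deriv (radialWeight m t)) s -
      (m + 2) * deriv (radialWeight m t) s =
      deriv (mollProfile m) s - (t ^ m)⁻¹ * (t ^ 2)⁻¹ * deriv (mollProfile m) (s / t ^ 2) := by
    intro s
    have h1 := (((hasDerivAt_id s).const_mul (-2)).mul (hw2 s)).sub ((hw1 s).const_mul (m : ℝ))
    have h2 := (hp s).sub (((hp (s / t ^ 2)).comp s
      ((hasDerivAt_id s).div_const (t ^ 2))).const_mul (t ^ m)⁻¹)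
    have h3 := h1.unique (h2.congr_of_eventuallyEq
      (Eventually.of_forall fun u => radialWeight_ode m ht ht1 u))
    simp only [id] at h3
    linear_combination h3
  have h := hG.2.2 _ (contDiff_affine_mul_radial hw.neg 0 e y₀)
    (hasCompactSupport_affine_mul_radial (q := fun s => -radialWeight m t s)
      (fun s hs => by rw [radialWeight_eq_zero_of_one_le m ht ht1 hs, neg_zero]) 0 e y₀)
  simp only [zero_sub, norm_neg, zero_add, inner_neg_right, neg_mul_neg] at h
  rw [← h]
  refine integral_congr_ae (Eventually.of_forall fun y => ?_)
  have hl := lap_affine_mul_radial (q := fun s => -radialWeight m t s)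
    (fun s => (hw1 s).neg) (fun s => (hw2 s).neg) 0 e y₀ y
  simp only [zero_add] at hl
  simp only [hl, ← hode]
  push_cast
  ring

lemma mollProfile_hasCompactSupport (m : ℕ) : HasCompactSupport (mollProfile m) := by
  refine HasCompactSupport.of_support_subset_isCompact (isCompact_Icc (a := (1 / 2 : ℝ)) (b := 1))
    fun s hs => ?_
  by_contra h
  rw [mem_Icc, not_and_or, not_le, not_le] at h
  exact hs (h.elim (mollProfile_eq_zero_of_lt m) (mollProfile_eq_zero_of_gt m))

lemma exists_mollProfile_le (m : ℕ) :
    ∃ H : ℝ, 0 < H ∧ (∀ s, |mollProfile m s| ≤ H) ∧ ∀ s, |deriv (mollProfile m) s| ≤ H := by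
  obtain ⟨A, hA⟩ := (mollProfile_hasCompactSupport m).exists_bound_of_continuous
    (mollProfile_contDiff m).continuous
  obtain ⟨B, hB⟩ := (mollProfile_hasCompactSupport m).deriv.exists_bound_of_continuous
    (contDiff_infty_iff_deriv.1 (mollProfile_contDiff m)).2.continuous
  exact ⟨max (max A B) 1, by positivity,
    fun s => (hA s).trans ((le_max_left _ _).trans (le_max_left _ _)),
    fun s => (hB s).trans ((le_max_right _ _).trans (le_max_left _ _))⟩

lemma mollProfile_scaled_eq_zero (m : ℕ) {t : ℝ} (ht : 0 < t) {r : ℝ} (hr : t < r) :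
    mollProfile m (r ^ 2 / t ^ 2) = 0 := by
  refine mollProfile_eq_zero_of_gt m ?_
  rw [lt_div_iff₀ (by positivity)]
  nlinarith

lemma mollProfile_radial_hasCompactSupport (m : ℕ) {t : ℝ} (ht : 0 < t) (y₀ : Euc m) :
    HasCompactSupport (fun y : Euc m => mollProfile m (‖y - y₀‖ ^ 2 / t ^ 2)) := by
  refine HasCompactSupport.of_support_subset_isCompact (isCompact_closedBall y₀ t) fun y hy => ?_
  by_contra h
  rw [mem_closedBall_iff_norm, not_le] at h
  exact hy (mollProfile_scaled_eq_zero m ht h)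

lemma mollProfile_radial_continuous (m : ℕ) (t : ℝ) (y₀ : Euc m) :
    Continuous (fun y : Euc m => mollProfile m (‖y - y₀‖ ^ 2 / t ^ 2)) :=
  (mollProfile_contDiff m).continuous.comp (by fun_prop)

lemma integral_mollProfile_pos {m : ℕ} (hm : 0 < m) :
    0 < ∫ y : Euc m, mollProfile m (‖y‖ ^ 2) := by
  have hc := mollProfile_radial_continuous m 1 (0 : Euc m)
  have hs := mollProfile_radial_hasCompactSupport m one_pos (0 : Euc m)
  simp only [sub_zero, one_pow, div_one] at hc hs
  obtain ⟨s, hs0, hsp⟩ := exists_mollProfile_pos m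
  refine hc.integral_pos_of_hasCompactSupport_nonneg_nonzero hs
    (fun y => mollProfile_nonneg m _) (x := EuclideanSpace.single ⟨0, hm⟩ √s) ?_
  simp only [PiLp.norm_single, Real.norm_eq_abs, sq_abs, Real.sq_sqrt hs0.le]
  exact hsp.ne'

lemma integral_mollProfile_scaled {m : ℕ} {t : ℝ} (ht : 0 < t) (y₀ : Euc m) :
    ∫ y : Euc m, (t ^ m)⁻¹ * mollProfile m (‖y - y₀‖ ^ 2 / t ^ 2) =
      ∫ y : Euc m, mollProfile m (‖y‖ ^ 2) := by
  rw [integral_sub_right_eq_self (fun y : Euc m => (t ^ m)⁻¹ * mollProfile m (‖y‖ ^ 2 / t ^ 2)) y₀,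
    integral_const_mul]
  have h := Measure.integral_comp_inv_smul_of_nonneg (volume : Measure (Euc m))
    (fun y => mollProfile m (‖y‖ ^ 2)) ht.le
  simp only [norm_smul, norm_inv, Real.norm_eq_abs, abs_of_pos ht, finrank_euclideanSpace,
    Fintype.card_fin, smul_eq_mul] at h
  have h' : ∀ y : Euc m, ‖y‖ ^ 2 / t ^ 2 = (t⁻¹ * ‖y‖) ^ 2 := fun y => by field_simp
  simp only [h']
  rw [h]
  field_simp

/-- Mollifying a locally integrable function recovers a multiple of it almost everywhere. -/
lemma ae_tendsto_mollification {m : ℕ} (hm : 0 < m) {G : Euc m → ℂ}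
    (hG : LocallyIntegrable G volume) :
    ∀ᵐ y₀ : Euc m, Tendsto
      (fun t : ℝ => ∫ y, ((t ^ m)⁻¹ * mollProfile m (‖y - y₀‖ ^ 2 / t ^ 2)) • G y) (𝓝[>] 0)
      (𝓝 ((∫ y : Euc m, mollProfile m (‖y‖ ^ 2)) • G y₀)) := by
  set c := ∫ y : Euc m, mollProfile m (‖y‖ ^ 2) with hc
  have hcpos : 0 < c := integral_mollProfile_pos hm
  obtain ⟨H, hH, hH1, -⟩ := exists_mollProfile_le m
  filter_upwards [(Besicovitch.vitaliFamily volume).ae_tendsto_average_norm_sub hG] with y₀ h₀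
  have h1 := h₀.comp (Besicovitch.tendsto_filterAt volume y₀)
  set V := volume.real (Metric.closedBall (0 : Euc m) 1)
  have hlim : Tendsto
      (fun t : ℝ => ∫ y, (c⁻¹ * ((t ^ m)⁻¹ * mollProfile m (‖y - y₀‖ ^ 2 / t ^ 2))) • G y) (𝓝[>] 0)
      (𝓝 (G y₀)) := by
    refine tendsto_integral_smul_of_tendsto_average_norm_sub (c⁻¹ * H * V) h1 ?_ ?_ ?_ ?_
    · exact Eventually.of_forall fun i => hG.integrableOn_isCompact (isCompact_closedBall _ _)
    · refine tendsto_const_nhds.congr' ?_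
      filter_upwards [self_mem_nhdsWithin] with t ht
      rw [integral_const_mul, integral_mollProfile_scaled ht, inv_mul_cancel₀ hcpos.ne']
    · filter_upwards [self_mem_nhdsWithin] with t ht y hy
      by_contra h
      rw [mem_closedBall_iff_norm, not_le] at h
      apply hy
      simp only
      rw [mollProfile_scaled_eq_zero m ht h, mul_zero, mul_zero]
    · filter_upwards [self_mem_nhdsWithin] with t ht y
      have ht' : 0 < t := ht
      have hV : 0 < V := by
        have := Metric.measure_closedBall_pos volume (0 : Euc m) one_pos
        exact ENNReal.toReal_pos this.ne' (isCompact_closedBall _ _).measure_lt_top.ne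
      rw [Measure.addHaar_real_closedBall' _ _ ht'.le, finrank_euclideanSpace, Fintype.card_fin,
        abs_mul, abs_mul, abs_of_pos (inv_pos.2 hcpos), abs_of_pos (inv_pos.2 (pow_pos ht' m))]
      have : c⁻¹ * H * V / (t ^ m * V) = c⁻¹ * ((t ^ m)⁻¹ * H) := by field_simp
      refine le_of_le_of_eq ?_ this.symm
      have := hH1 (‖y - y₀‖ ^ 2 / t ^ 2)
      gcongr
  have h2 := hlim.const_smul c
  refine h2.congr fun t => ?_
  rw [← integral_smul]
  refine integral_congr_ae (Eventually.of_forall fun y => ?_)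
  simp only [smul_smul]
  rw [mul_inv_cancel_left₀ hcpos.ne']

/-- A square integrable majorant of all the truncated fundamental solutions. -/
def fundMajorant (m : ℕ) : Euc m → ℝ :=
  (Metric.ball 0 1).indicator fun y => 4 * ‖y‖ ^ (-((m : ℝ) - 7 / 4))

lemma fundMajorant_measurable (m : ℕ) : Measurable (fundMajorant m) := by
  refine Measurable.indicator ?_ measurableSet_ball
  fun_prop

lemma fundMajorant_nonneg (m : ℕ) (y : Euc m) : 0 ≤ fundMajorant m y :=
  indicator_nonneg (fun _ _ => by positivity) y

lemma fundProfile_le_fundMajorant {m : ℕ} (hm : 2 ≤ m) {t : ℝ} (ht : 0 < t) (ht1 : t ≤ 1)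
    {y : Euc m} (hy : y ≠ 0) : fundProfile m t (‖y‖ ^ 2) ≤ fundMajorant m y := by
  have hy' : 0 < ‖y‖ := norm_pos_iff.2 hy
  by_cases h : ‖y‖ < 1
  · rw [fundMajorant, indicator_of_mem (by simpa using h)]
    refine (fundProfile_le m hm ht ht1 (by positivity)).trans_eq ?_
    rw [← Real.rpow_natCast, ← Real.rpow_mul hy'.le]
    congr 2
    push_cast
    ring
  · rw [fundProfile_eq_zero m ht ht1 (by nlinarith)]
    exact fundMajorant_nonneg m y

lemma lintegral_fundMajorant_sq_lt_top {m : ℕ} (hm : m = 2 ∨ m = 3) :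
    ∫⁻ y : Euc m, ENNReal.ofReal (fundMajorant m y) ^ 2 < ⊤ := by
  have hm2 : (m : ℝ) ≤ 3 := by rcases hm with rfl | rfl <;> norm_num
  have hm1 : 1 ≤ m := by omega
  have hint : IntegrableOn (fun y : Euc m => (fundMajorant m y) ^ 2) (Metric.ball 0 1) := by
    refine integrableOn_ball_of_norm_le_rpow (C := 16) (α := 2 * ((m : ℝ) - 7 / 4))
      (by simpa using hm1) (by rw [finrank_euclideanSpace, Fintype.card_fin]; linarith) ?_
      ((fundMajorant_measurable m).pow_const 2).aestronglyMeasurable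
    filter_upwards [ae_restrict_mem measurableSet_ball] with y hy
    rw [fundMajorant, indicator_of_mem hy, Real.norm_eq_abs, abs_of_nonneg (by positivity),
      mul_pow, ← Real.rpow_mul_natCast (norm_nonneg _)]
    refine le_of_eq ?_
    norm_num
    congr 1
    ring
  have := hint.lintegral_lt_top
  refine lt_of_eq_of_lt ?_ this
  rw [← lintegral_indicator measurableSet_ball]
  refine lintegral_congr fun y => ?_
  by_cases hy : y ∈ Metric.ball (0 : Euc m) 1
  · rw [indicator_of_mem hy, ENNReal.ofReal_pow (fundMajorant_nonneg m y)]
  · rw [indicator_of_notMem hy, fundMajorant, indicator_of_notMem hy]; simp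

lemma IsFundSol.norm_mollification_le {m : ℕ} {k : ℝ} {G : Euc m → ℂ} (hG : IsFundSol k G)
    (hm : 2 ≤ m) {t : ℝ} (ht : 0 < t) (ht1 : t ≤ 1) {H R : ℝ}
    (hH : ∀ s, |mollProfile m s| ≤ H) {y₀ : Euc m} (hy₀ : y₀ ≠ 0) (hR : ‖y₀‖ ≤ R) :
    ‖∫ y, ((t ^ m)⁻¹ * mollProfile m (‖y - y₀‖ ^ 2 / t ^ 2)) • G y‖ₑ ≤
      ENNReal.ofReal (fundMajorant m y₀) +
        ENNReal.ofReal H * (∫⁻ y in Metric.closedBall 0 (R + 1), ‖G y‖ₑ) +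
        ENNReal.ofReal (k ^ 2) * ∫⁻ y in Metric.closedBall 0 (R + 1),
          ‖G y‖ₑ * ENNReal.ofReal (fundMajorant m (y - y₀)) := by
  set K := Metric.closedBall (0 : Euc m) (R + 1)
  have hK : MeasurableSet K := measurableSet_closedBall
  have hmemK : ∀ y, ‖y - y₀‖ ≤ 1 → y ∈ K := fun y hy => by
    rw [mem_closedBall_zero_iff]
    linarith [norm_le_norm_add_norm_sub' y y₀]
  have hGl := hG.2.1
  have hc1 := mollProfile_radial_continuous m 1 y₀
  have hs1 := mollProfile_radial_hasCompactSupport m one_pos y₀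
  simp only [one_pow, div_one] at hc1 hs1
  have hcf : Continuous (fun y : Euc m => fundProfile m t (‖y - y₀‖ ^ 2)) :=
    (fundProfile_contDiff m ht ht1).continuous.comp (by fun_prop)
  have hf0 : ∀ y, 1 < ‖y - y₀‖ → fundProfile m t (‖y - y₀‖ ^ 2) = 0 := fun y hy =>
    fundProfile_eq_zero m ht ht1 (by nlinarith)
  have hsf : HasCompactSupport (fun y : Euc m => fundProfile m t (‖y - y₀‖ ^ 2)) := by
    refine HasCompactSupport.of_support_subset_isCompact (isCompact_closedBall y₀ 1) fun y hy => ?_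
    by_contra h
    rw [mem_closedBall_iff_norm, not_le] at h
    exact hy (hf0 y h)
  have i1 := hGl.integrable_smul_left_of_hasCompactSupport hc1 hs1
  have i2 : Integrable fun y => ((t ^ m)⁻¹ * mollProfile m (‖y - y₀‖ ^ 2 / t ^ 2)) • G y := by
    have := (hGl.integrable_smul_left_of_hasCompactSupport (mollProfile_radial_continuous m t y₀)
      (mollProfile_radial_hasCompactSupport m ht y₀)).smul ((t ^ m)⁻¹)
    simpa only [smul_smul, Pi.smul_apply, Pi.smul_def] using this
  have i12 : Integrable fun y => mollProfile m (‖y - y₀‖ ^ 2) • G y -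
      ((t ^ m)⁻¹ * mollProfile m (‖y - y₀‖ ^ 2 / t ^ 2)) • G y := i1.sub i2
  have i3 : Integrable fun y => (k ^ 2) • fundProfile m t (‖y - y₀‖ ^ 2) • G y :=
    (hGl.integrable_smul_left_of_hasCompactSupport hcf hsf).smul (k ^ 2)
  have hid : ∫ y, ((t ^ m)⁻¹ * mollProfile m (‖y - y₀‖ ^ 2 / t ^ 2)) • G y =
      (fundProfile m t (‖y₀‖ ^ 2) : ℂ) + (∫ y, mollProfile m (‖y - y₀‖ ^ 2) • G y) +
        k ^ 2 • ∫ y, fundProfile m t (‖y - y₀‖ ^ 2) • G y := by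
    have h := hG.integral_mul_fundProfile ht ht1 y₀
    have h' : ∫ y, (mollProfile m (‖y - y₀‖ ^ 2) • G y -
        ((t ^ m)⁻¹ * mollProfile m (‖y - y₀‖ ^ 2 / t ^ 2)) • G y +
        (k ^ 2) • fundProfile m t (‖y - y₀‖ ^ 2) • G y) = -(fundProfile m t (‖y₀‖ ^ 2) : ℂ) := by
      rw [← h]
      refine integral_congr_ae (Eventually.of_forall fun y => ?_)
      simp only [Complex.real_smul]
      push_cast
      ring
    rw [integral_add i12 i3, integral_sub i1 i2, integral_smul] at h'
    linear_combination -h'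
  have b1 : ‖∫ y, mollProfile m (‖y - y₀‖ ^ 2) • G y‖ₑ ≤
      ENNReal.ofReal H * ∫⁻ y in K, ‖G y‖ₑ := by
    refine (enorm_integral_le_lintegral_enorm _).trans ?_
    rw [← lintegral_const_mul' _ _ ENNReal.ofReal_ne_top, ← lintegral_indicator hK]
    refine lintegral_mono fun y => ?_
    by_cases hy : ‖y - y₀‖ ≤ 1
    · rw [indicator_of_mem (hmemK y hy), enorm_smul]
      gcongr
      rw [Real.enorm_eq_ofReal_abs]
      exact ENNReal.ofReal_le_ofReal (hH _)
    · have : mollProfile m (‖y - y₀‖ ^ 2) = 0 :=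
        mollProfile_eq_zero_of_gt m (by nlinarith [not_le.1 hy])
      simp [this]
  have b2 : ‖∫ y, fundProfile m t (‖y - y₀‖ ^ 2) • G y‖ₑ ≤
      ∫⁻ y in K, ‖G y‖ₑ * ENNReal.ofReal (fundMajorant m (y - y₀)) := by
    refine (enorm_integral_le_lintegral_enorm _).trans ?_
    rw [← lintegral_indicator hK]
    have hne : ∀ᵐ y : Euc m, y ≠ y₀ := by
      have : Nontrivial (Euc m) := ⟨y₀, 0, hy₀⟩
      exact Measure.ae_ne volume y₀
    refine lintegral_mono_ae ?_
    filter_upwards [hne] with y hyne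
    by_cases hy : ‖y - y₀‖ ≤ 1
    · rw [indicator_of_mem (hmemK y hy), enorm_smul, mul_comm]
      gcongr
      rw [Real.enorm_eq_ofReal_abs, abs_of_nonneg (fundProfile_nonneg m ht ht1)]
      exact ENNReal.ofReal_le_ofReal
        (fundProfile_le_fundMajorant hm ht ht1 (sub_ne_zero.2 hyne))
    · simp [hf0 y (not_le.1 hy)]
  rw [hid]
  refine (enorm_add_le _ _).trans (add_le_add ((enorm_add_le _ _).trans (add_le_add ?_ b1)) ?_)
  · rw [← ofReal_norm, Complex.norm_real, Real.norm_eq_abs,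
      abs_of_nonneg (fundProfile_nonneg m ht ht1)]
    exact ENNReal.ofReal_le_ofReal (fundProfile_le_fundMajorant hm ht ht1 hy₀)
  · rw [enorm_smul, Real.enorm_eq_ofReal_abs, abs_of_nonneg (sq_nonneg k)]
    gcongr

/-- Young's inequality `‖g * p‖₂ ≤ ‖g‖₁ ‖p‖₂`. -/
lemma lintegral_sq_lintegral_mul_le {m : ℕ} {g p : Euc m → ℝ≥0∞} {μ : Measure (Euc m)} [SFinite μ]
    (hg : AEMeasurable g μ) (hp : Measurable p) :
    ∫⁻ z, (∫⁻ y, g y * p (y - z) ∂μ) ^ 2 ≤ (∫⁻ y, g y ∂μ) ^ 2 * ∫⁻ y, p y ^ 2 := by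
  have h1 : ∀ z, (∫⁻ y, g y * p (y - z) ∂μ) ^ 2 ≤
      (∫⁻ y, g y ∂μ) * ∫⁻ y, g y * p (y - z) ^ 2 ∂μ := by
    intro z
    have h := ENNReal.lintegral_mul_norm_pow_le (μ := μ) (f := g)
      (g := fun y => g y * p (y - z) ^ 2) hg (by fun_prop) (p := 1 / 2) (q := 1 / 2)
      (by norm_num) (by norm_num) (by norm_num)
    have e : ∀ y, g y ^ (1 / 2 : ℝ) * (g y * p (y - z) ^ 2) ^ (1 / 2 : ℝ) = g y * p (y - z) := by
      intro y
      rw [ENNReal.mul_rpow_of_nonneg _ _ (by norm_num), ← mul_assoc,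
        ← ENNReal.rpow_add_of_nonneg _ _ (by norm_num) (by norm_num), ← ENNReal.rpow_natCast,
        ← ENNReal.rpow_mul]
      norm_num
    simp only [e] at h
    calc _ ≤ _ := pow_le_pow_left₀ zero_le h 2
      _ = _ := by
        rw [mul_pow, ← ENNReal.rpow_mul_natCast, ← ENNReal.rpow_mul_natCast]
        norm_num
  calc _ ≤ ∫⁻ z, (∫⁻ y, g y ∂μ) * ∫⁻ y, g y * p (y - z) ^ 2 ∂μ := lintegral_mono h1
    _ = (∫⁻ y, g y ∂μ) * ∫⁻ z, ∫⁻ y, g y * p (y - z) ^ 2 ∂μ := by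
      refine lintegral_const_mul'' _ ?_
      refine AEMeasurable.lintegral_prod_right' (f := fun q : Euc m × Euc m =>
        g q.2 * p (q.2 - q.1) ^ 2) ?_
      exact hg.comp_snd.mul (by fun_prop)
    _ = (∫⁻ y, g y ∂μ) * ∫⁻ y, (∫⁻ z, g y * p (y - z) ^ 2) ∂μ := by
      rw [lintegral_lintegral_swap]
      exact hg.comp_snd.mul (by fun_prop)
    _ = (∫⁻ y, g y ∂μ) * ∫⁻ y, g y * (∫⁻ z, p z ^ 2) ∂μ := by
      congr 1
      refine lintegral_congr fun y => ?_
      rw [lintegral_const_mul _ (by fun_prop), lintegral_sub_left_eq_self (fun z => p z ^ 2) y]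
    _ = _ := by
      rw [lintegral_mul_const'' _ hg]
      ring

/-- Fundamental solutions of the Helmholtz equation in dimensions `2` and `3` are locally square
integrable. -/
lemma IsFundSol.memLp_two {m : ℕ} {k : ℝ} {G : Euc m → ℂ} (hG : IsFundSol k G)
    (hm : m = 2 ∨ m = 3) (R : ℝ) :
    MemLp G 2 (volume.restrict (Metric.closedBall 0 R)) := by
  have hm2 : 2 ≤ m := by omega
  have hm0 : 0 < m := by omega
  have : Nontrivial (Euc m) :=
    Module.nontrivial_of_finrank_pos (R := ℝ) (by simpa using hm0)
  obtain ⟨H, hH0, hH, -⟩ := exists_mollProfile_le m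
  set c := ∫ y : Euc m, mollProfile m (‖y‖ ^ 2)
  have hc : 0 < c := integral_mollProfile_pos hm0
  set K := Metric.closedBall (0 : Euc m) (R + 1)
  set p : Euc m → ℝ≥0∞ := fun y => ENNReal.ofReal (fundMajorant m y)
  have hp : Measurable p := (fundMajorant_measurable m).ennreal_ofReal
  have hp2 : ∫⁻ y, p y ^ 2 < ⊤ := lintegral_fundMajorant_sq_lt_top hm
  set A := ∫⁻ y in K, ‖G y‖ₑ
  have hGK : IntegrableOn G K := hG.2.1.integrableOn_isCompact (isCompact_closedBall _ _)
  have hA : A < ⊤ := hGK.2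
  set I : Euc m → ℝ≥0∞ := fun z => ∫⁻ y in K, ‖G y‖ₑ * p (y - z)
  have hGm : AEMeasurable (fun y => ‖G y‖ₑ) (volume.restrict K) := hGK.1.enorm
  have hI2 : ∫⁻ z, I z ^ 2 < ⊤ :=
    (lintegral_sq_lintegral_mul_le hGm hp).trans_lt (ENNReal.mul_lt_top (by finiteness) hp2)
  have hIm : AEMeasurable I := by
    refine AEMeasurable.lintegral_prod_right' (f := fun q : Euc m × Euc m =>
      ‖G q.2‖ₑ * p (q.2 - q.1)) ?_
    exact hGm.comp_snd.mul (by fun_prop)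
  have hbound : ∀ᵐ z ∂volume.restrict (Metric.closedBall (0 : Euc m) R),
      ‖c • G z‖ₑ ≤ p z + ENNReal.ofReal H * A + ENNReal.ofReal (k ^ 2) * I z := by
    filter_upwards [ae_restrict_of_ae (ae_tendsto_mollification hm0 hG.2.1),
      ae_restrict_of_ae (Measure.ae_ne volume (0 : Euc m)),
      ae_restrict_mem measurableSet_closedBall] with z hz hz0 hzR
    refine le_of_tendsto hz.enorm ?_
    filter_upwards [Ioc_mem_nhdsGT one_pos] with t ht
    exact hG.norm_mollification_le hm2 ht.1 ht.2 hH hz0 (by simpa using hzR)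
  have memLp_of : ∀ f : Euc m → ℝ≥0∞, AEMeasurable f → ∫⁻ z, f z ^ 2 < ⊤ →
      MemLp f 2 (volume.restrict (Metric.closedBall (0 : Euc m) R)) := by
    intro f hf h
    refine MemLp.restrict _ ⟨hf.aestronglyMeasurable, ?_⟩
    rw [eLpNorm_lt_top_iff_lintegral_rpow_enorm_lt_top two_ne_zero ENNReal.ofNat_ne_top]
    simpa using h
  have hfin : IsFiniteMeasure (volume.restrict (Metric.closedBall (0 : Euc m) R)) :=
    ⟨by simpa using (isCompact_closedBall (0 : Euc m) R).measure_lt_top⟩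
  have hc1 : MemLp (fun _ : Euc m => ENNReal.ofReal H * A) 2
      (volume.restrict (Metric.closedBall (0 : Euc m) R)) :=
    memLp_const_enorm (by simp only [enorm_eq_self]; finiteness)
  have hI' : ∫⁻ z, (ENNReal.ofReal (k ^ 2) * I z) ^ 2 < ⊤ := by
    simp only [mul_pow]
    rw [lintegral_const_mul' _ _ (by finiteness)]
    exact ENNReal.mul_lt_top (by finiteness) hI2
  have hsum := ((memLp_of p hp.aemeasurable hp2).add hc1).add
    (memLp_of _ (hIm.const_mul (ENNReal.ofReal (k ^ 2))) hI')
  have hcG : MemLp (fun z => c • G z) 2 (volume.restrict (Metric.closedBall (0 : Euc m) R)) :=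
    hsum.mono'_enorm (hG.2.1.aestronglyMeasurable.restrict.const_smul c) hbound
  have := hcG.const_smul c⁻¹
  refine this.ae_eq (Eventually.of_forall fun z => ?_)
  exact inv_smul_smul₀ hc.ne' (G z)

/-- An (unnormalized) smooth bump supported in the closed ball of radius `t` around `y₀`. -/
def mollBump (m : ℕ) (t : ℝ) (y₀ y : Euc m) : ℝ :=
  (t ^ m)⁻¹ * mollProfile m (‖y - y₀‖ ^ 2 / t ^ 2)

/-- The derivative of `mollBump` in the direction `e`. -/
def mollBumpDeriv (m : ℕ) (t : ℝ) (e y₀ y : Euc m) : ℝ :=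
  2 * ⟪e, y - y₀⟫ * ((t ^ m)⁻¹ * (t ^ 2)⁻¹ * deriv (mollProfile m) (‖y - y₀‖ ^ 2 / t ^ 2))

lemma continuous_mollBump (m : ℕ) (t : ℝ) (y₀ : Euc m) : Continuous (mollBump m t y₀) :=
  continuous_const.mul (mollProfile_radial_continuous m t y₀)

lemma continuous_mollBumpDeriv (m : ℕ) (t : ℝ) (e y₀ : Euc m) :
    Continuous (mollBumpDeriv m t e y₀) := by
  have h : Continuous (deriv (mollProfile m)) :=
    (contDiff_infty_iff_deriv.1 (mollProfile_contDiff m)).2.continuous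
  unfold mollBumpDeriv
  fun_prop

lemma mollBump_eq_zero (m : ℕ) {t : ℝ} (ht : 0 < t) {y₀ y : Euc m} (hy : t < ‖y - y₀‖) :
    mollBump m t y₀ y = 0 := by
  rw [mollBump, mollProfile_scaled_eq_zero m ht hy, mul_zero]

lemma mollBumpDeriv_eq_zero (m : ℕ) {t : ℝ} (ht : 0 < t) (e : Euc m) {y₀ y : Euc m}
    (hy : t < ‖y - y₀‖) : mollBumpDeriv m t e y₀ y = 0 := by
  have h1 : 1 < ‖y - y₀‖ ^ 2 / t ^ 2 := by
    rw [lt_div_iff₀ (by positivity)]; nlinarith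
  have : mollProfile m =ᶠ[𝓝 (‖y - y₀‖ ^ 2 / t ^ 2)] fun _ => 0 := by
    filter_upwards [lt_mem_nhds h1] with u hu using mollProfile_eq_zero_of_gt m hu
  rw [mollBumpDeriv, this.deriv_eq]
  simp

lemma tsupport_mollBump_subset (m : ℕ) {t : ℝ} (ht : 0 < t) (y₀ : Euc m) :
    tsupport (mollBump m t y₀) ⊆ Metric.closedBall y₀ t := by
  refine closure_minimal (fun y hy => ?_) Metric.isClosed_closedBall
  by_contra h
  rw [mem_closedBall_iff_norm, not_le] at h
  exact hy (mollBump_eq_zero m ht h)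

lemma hasCompactSupport_mollBumpDeriv (m : ℕ) {t : ℝ} (ht : 0 < t) (e y₀ : Euc m) :
    HasCompactSupport (mollBumpDeriv m t e y₀) := by
  refine HasCompactSupport.of_support_subset_isCompact (isCompact_closedBall y₀ t) fun y hy => ?_
  by_contra h
  rw [mem_closedBall_iff_norm, not_le] at h
  exact hy (mollBumpDeriv_eq_zero m ht e h)

lemma hasLineDerivAt_mollBump (m : ℕ) (t : ℝ) (e y₀ y : Euc m) :
    HasLineDerivAt ℝ (mollBump m t y₀) (mollBumpDeriv m t e y₀ y) y e := by
  have hq : HasDerivAt (fun s => (t ^ m)⁻¹ * mollProfile m (s / t ^ 2))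
      ((t ^ m)⁻¹ * (deriv (mollProfile m) (‖y - y₀‖ ^ 2 / t ^ 2) * (1 / t ^ 2)))
      (‖y - y₀‖ ^ 2) := by
    have h := ((contDiff_infty_iff_deriv.1 (mollProfile_contDiff m)).1
      (‖y - y₀‖ ^ 2 / t ^ 2)).hasDerivAt
    exact (h.comp (‖y - y₀‖ ^ 2) ((hasDerivAt_id (‖y - y₀‖ ^ 2)).div_const (t ^ 2))).const_mul _
  have h := (hasFDerivAt_radial y₀ y hq).hasLineDerivAt e
  refine h.congr_deriv ?_
  simp only [_root_.smul_apply, innerSL_apply_apply, smul_eq_mul,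
    real_inner_comm, mollBumpDeriv]
  ring

lemma radialWeight_sq_le (m : ℕ) {t : ℝ} {a : ℝ} (ha : 0 < a) :
    radialWeight m t (a ^ 2) ≤ (a ^ m)⁻¹ := by
  refine (radialWeight_le m (by positivity)).trans (le_of_eq ?_)
  rw [← Real.rpow_natCast a 2, ← Real.rpow_mul ha.le, ← Real.rpow_natCast a m,
    ← Real.rpow_neg ha.le]
  congr 1
  push_cast
  ring

/-- The truncated weight, rescaled, is dominated by a power of the relative distance. -/
lemma abs_inner_mul_radialWeight_le {m : ℕ} (hm : 2 ≤ m) {t : ℝ} (ht : 0 < t) (ht1 : t ≤ 1)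
    {e : Euc m} (he : ‖e‖ = 1) {ε : ℝ} (hε : 0 ≤ ε) (w : Euc m) :
    ε ^ (m - 1) * |⟪e, w⟫ * radialWeight m t (‖w‖ ^ 2)| ≤ (ε / ‖w‖) ^ (m - 1) := by
  rcases eq_or_ne w 0 with rfl | hw
  · simp only [inner_zero_right, zero_mul, abs_zero, mul_zero]
    positivity
  have hw' : 0 < ‖w‖ := norm_pos_iff.2 hw
  rw [abs_mul, abs_of_nonneg (radialWeight_nonneg m ht ht1), div_pow, div_eq_mul_inv]
  gcongr
  have h1 : |⟪e, w⟫| ≤ ‖w‖ := by simpa [he] using abs_real_inner_le_norm e w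
  calc |⟪e, w⟫| * radialWeight m t (‖w‖ ^ 2) ≤ ‖w‖ * (‖w‖ ^ m)⁻¹ :=
        mul_le_mul h1 (radialWeight_sq_le m hw') (radialWeight_nonneg m ht ht1) hw'.le
    _ = (‖w‖ ^ (m - 1))⁻¹ := by
        obtain ⟨n, rfl⟩ : ∃ n, m = n + 1 := ⟨m - 1, by omega⟩
        rw [Nat.add_sub_cancel, pow_succ]
        field_simp

lemma abs_inner_mul_radialWeight_le_const {m : ℕ} (hm : 2 ≤ m) {r ε : ℝ} (hr : 0 < r)
    (hε : 0 < ε) (hrε : r * ε ≤ 1) {e : Euc m} (he : ‖e‖ = 1) (w : Euc m) :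
    ε ^ (m - 1) * |⟪e, w⟫ * radialWeight m (r * ε) (‖w‖ ^ 2)| ≤ (2 / r) ^ (m - 1) := by
  have ht : 0 < r * ε := mul_pos hr hε
  rcases le_or_gt (‖w‖ ^ 2) ((r * ε) ^ 2 / 2) with h | h
  · rw [radialWeight_eq_zero_of_le m ht hrε h, mul_zero, abs_zero, mul_zero]
    positivity
  · refine (abs_inner_mul_radialWeight_le hm ht hrε he hε.le w).trans ?_
    have hlow : r * ε / 2 ≤ ‖w‖ := by
      by_contra hlt
      nlinarith [norm_nonneg w]
    refine pow_le_pow_left₀ (by positivity) ?_ _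
    calc ε / ‖w‖ ≤ ε / (r * ε / 2) := by gcongr
      _ = 2 / r := by field_simp

/-- Averages of a fundamental solution against derivatives of bumps centred at `ε • e` with
radius `r * ε` blow up like `ε ^ (1 - m)`. -/
lemma IsFundSol.tendsto_integral_mollBumpDeriv {m : ℕ} {k : ℝ} {G : Euc m → ℂ}
    (hG : IsFundSol k G) (hm : 2 ≤ m) {e : Euc m} (he : ‖e‖ = 1) {r : ℝ} (hr : 0 < r)
    (hr1 : r ≤ 1) :
    Tendsto (fun ε : ℝ => ε ^ (m - 1) • ∫ y, mollBumpDeriv m (r * ε) e (ε • e) y • G y)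
      (𝓝[>] 0) (𝓝 1) := by
  obtain ⟨H, hH0, -, hH⟩ := exists_mollProfile_le m
  have hGl := hG.2.1
  have : Nontrivial (Euc m) := ⟨e, 0, fun h => by simp [h] at he⟩
  set F : ℝ → Euc m → ℝ := fun ε y => mollBumpDeriv m 1 e (ε • e) y -
    k ^ 2 * (⟪e, y - ε • e⟫ * radialWeight m (r * ε) (‖y - ε • e‖ ^ 2)) with hF
  have hFc : ∀ ε ∈ Ioc (0 : ℝ) (1 / 2), Continuous (F ε) := fun ε hε => by
    have h := (radialWeight_contDiff m (mul_pos hr hε.1)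
      (by nlinarith [hε.1, hε.2] : r * ε ≤ 1)).continuous
    have h' := continuous_mollBumpDeriv m 1 e (ε • e)
    fun_prop
  have hF0 : ∀ ε ∈ Ioc (0 : ℝ) (1 / 2), ∀ y, 1 < ‖y - ε • e‖ → F ε y = 0 := fun ε hε y hy => by
    simp only [hF]
    rw [mollBumpDeriv_eq_zero m one_pos e hy, radialWeight_eq_zero_of_one_le m (mul_pos hr hε.1)
      (by nlinarith [hε.1, hε.2] : r * ε ≤ 1) (by nlinarith)]
    simp
  have hFb : ∀ ε ∈ Ioc (0 : ℝ) (1 / 2), ∀ y, |ε ^ (m - 1) * F ε y| ≤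
      ε ^ (m - 1) * (2 * H) + k ^ 2 * (ε ^ (m - 1) *
        |⟪e, y - ε • e⟫ * radialWeight m (r * ε) (‖y - ε • e‖ ^ 2)|) := fun ε hε y => by
    have hp : |mollBumpDeriv m 1 e (ε • e) y| ≤ 2 * H := by
      rcases lt_or_ge 1 ‖y - ε • e‖ with h | h
      · rw [mollBumpDeriv_eq_zero m one_pos e h, abs_zero]; positivity
      · have h1 : |⟪e, y - ε • e⟫| ≤ 1 :=
          (abs_real_inner_le_norm e _).trans (by rw [he, one_mul]; exact h)
        simp only [mollBumpDeriv, one_pow, inv_one, one_mul, abs_mul, Nat.abs_ofNat]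
        have := hH (‖y - ε • e‖ ^ 2 / 1)
        nlinarith [abs_nonneg ⟪e, y - ε • e⟫,
          abs_nonneg (deriv (mollProfile m) (‖y - ε • e‖ ^ 2 / 1))]
    have hε0 : 0 ≤ ε ^ (m - 1) := pow_nonneg hε.1.le _
    calc |ε ^ (m - 1) * F ε y| = ε ^ (m - 1) * |F ε y| := by rw [abs_mul, abs_of_nonneg hε0]
      _ ≤ ε ^ (m - 1) * (|mollBumpDeriv m 1 e (ε • e) y| +
          k ^ 2 * |⟪e, y - ε • e⟫ * radialWeight m (r * ε) (‖y - ε • e‖ ^ 2)|) := by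
        gcongr
        refine (abs_sub _ _).trans_eq ?_
        rw [abs_mul (k ^ 2), abs_of_nonneg (sq_nonneg k)]
      _ = ε ^ (m - 1) * |mollBumpDeriv m 1 e (ε • e) y| + k ^ 2 * (ε ^ (m - 1) *
          |⟪e, y - ε • e⟫ * radialWeight m (r * ε) (‖y - ε • e‖ ^ 2)|) := by ring
      _ ≤ _ := by gcongr
  have hev : ∀ᶠ ε : ℝ in 𝓝[>] 0, ε ∈ Ioc (0 : ℝ) (1 / 2) := Ioc_mem_nhdsGT one_half_pos
  have herr : Tendsto (fun ε : ℝ => ∫ y, (ε ^ (m - 1) * F ε y) • G y) (𝓝[>] 0) (𝓝 0) := by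
    rw [← integral_zero (Euc m) ℂ (μ := volume)]
    refine tendsto_integral_filter_of_dominated_convergence
      ((Metric.closedBall (0 : Euc m) 2).indicator
        fun y => (2 * H + k ^ 2 * (2 / r) ^ (m - 1)) * ‖G y‖) ?_ ?_ ?_ ?_
    · filter_upwards [hev] with ε hε
      exact ((hFc ε hε).const_mul _).aestronglyMeasurable.smul hGl.aestronglyMeasurable
    · filter_upwards [hev] with ε hε
      refine Eventually.of_forall fun y => ?_
      rcases lt_or_ge 1 ‖y - ε • e‖ with h | h
      · rw [hF0 ε hε y h, mul_zero, zero_smul, norm_zero]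
        refine indicator_nonneg (fun y _ => ?_) y
        positivity
      · have hy : y ∈ Metric.closedBall (0 : Euc m) 2 := by
          rw [mem_closedBall_zero_iff]
          have := norm_le_norm_add_norm_sub' y (ε • e)
          rw [norm_smul, he, mul_one, Real.norm_eq_abs, abs_of_pos hε.1] at this
          linarith [hε.2]
        rw [indicator_of_mem hy, norm_smul, Real.norm_eq_abs]
        gcongr
        have hε1 : ε ^ (m - 1) ≤ 1 := pow_le_one₀ hε.1.le (by linarith [hε.2])
        refine (hFb ε hε y).trans ?_
        have h1 : ε ^ (m - 1) * (2 * H) ≤ 2 * H := mul_le_of_le_one_left (by positivity) hε1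
        have h2 := abs_inner_mul_radialWeight_le_const hm hr hε.1
          (by nlinarith [hε.1, hε.2]) he (y - ε • e)
        gcongr
    · rw [integrable_indicator_iff measurableSet_closedBall]
      exact (hGl.integrableOn_isCompact (isCompact_closedBall _ _)).norm.const_mul _
    · filter_upwards [Measure.ae_ne volume (0 : Euc m)] with y hy
      rw [← zero_smul ℝ (G y)]
      refine Tendsto.smul_const ?_ _
      refine squeeze_zero_norm' (a := fun ε : ℝ => ε ^ (m - 1) * (2 * H) +
          k ^ 2 * (ε / ‖y - ε • e‖) ^ (m - 1)) ?_ ?_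
      · filter_upwards [hev] with ε hε
        have hw := abs_inner_mul_radialWeight_le hm (mul_pos hr hε.1)
          (by nlinarith [hε.1, hε.2] : r * ε ≤ 1) he hε.1.le (y - ε • e)
        refine (hFb ε hε y).trans ?_
        gcongr
      have hc : ContinuousAt (fun ε : ℝ => ε ^ (m - 1) * (2 * H) +
          k ^ 2 * (ε / ‖y - ε • e‖) ^ (m - 1)) 0 := by
        refine ContinuousAt.add (by fun_prop) (continuousAt_const.mul (ContinuousAt.pow ?_ _))
        exact continuousAt_id.div (by fun_prop) (by simpa using hy)
      have h := hc.tendsto.mono_left (nhdsWithin_le_nhds (s := Ioi 0))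
      have hm1 : m - 1 ≠ 0 := by omega
      simpa [zero_pow hm1] using h
  have hmain : ∀ ε ∈ Ioc (0 : ℝ) (1 / 2),
      ε ^ (m - 1) • ∫ y, mollBumpDeriv m (r * ε) e (ε • e) y • G y =
        1 + ∫ y, (ε ^ (m - 1) * F ε y) • G y := fun ε hε => by
    have ht : 0 < r * ε := mul_pos hr hε.1
    have ht1 : r * ε ≤ 1 := by nlinarith [hε.1, hε.2]
    have i1 : Integrable fun y => F ε y • G y :=
      hGl.integrable_smul_left_of_hasCompactSupport (hFc ε hε)
        (HasCompactSupport.of_support_subset_isCompact (isCompact_closedBall (ε • e) 1)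
          fun y hy => by
            by_contra h
            rw [mem_closedBall_iff_norm, not_le] at h
            exact hy (hF0 ε hε y h))
    have i2 : Integrable fun y => mollBumpDeriv m (r * ε) e (ε • e) y • G y :=
      hGl.integrable_smul_left_of_hasCompactSupport (continuous_mollBumpDeriv _ _ _ _)
        (hasCompactSupport_mollBumpDeriv m ht _ _)
    have h := hG.integral_mul_radialWeight ht ht1 e (ε • e)
    have hval : ⟪e, ε • e⟫ * radialWeight m (r * ε) (‖ε • e‖ ^ 2) = (ε ^ (m - 1))⁻¹ := by
      rw [norm_smul, he, mul_one, Real.norm_eq_abs, abs_of_pos hε.1, radialWeight_eq m ht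
        (by gcongr; nlinarith [hε.1]) (by nlinarith [hε.1, hε.2]), inner_smul_right,
        real_inner_self_eq_norm_sq, he, ← Real.rpow_natCast ε 2, ← Real.rpow_mul hε.1.le]
      have : ((2 : ℕ) : ℝ) * (-(m : ℝ) / 2) = -(m : ℝ) := by push_cast; ring
      rw [this, Real.rpow_neg hε.1.le, Real.rpow_natCast]
      have := hε.1.ne'
      obtain ⟨n, rfl⟩ : ∃ n, m = n + 1 := ⟨m - 1, by omega⟩
      rw [Nat.add_sub_cancel]
      field_simp
      ring
    rw [hval] at h
    have h' : ∫ y, (F ε y • G y - mollBumpDeriv m (r * ε) e (ε • e) y • G y) =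
        -(((ε ^ (m - 1))⁻¹ : ℝ) : ℂ) := by
      rw [← h]
      refine integral_congr_ae (Eventually.of_forall fun y => ?_)
      simp only [Complex.real_smul, hF, mollBumpDeriv, one_pow, inv_one, div_one]
      push_cast
      ring
    rw [integral_sub i1 i2] at h'
    have h'' : ∫ y, mollBumpDeriv m (r * ε) e (ε • e) y • G y =
        (((ε ^ (m - 1))⁻¹ : ℝ) : ℂ) + ∫ y, F ε y • G y := by linear_combination -h'
    simp only [mul_smul]
    rw [h'', integral_smul, smul_add, Complex.real_smul, ← Complex.ofReal_mul,
      mul_inv_cancel₀ (pow_ne_zero _ hε.1.ne'), Complex.ofReal_one]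
  have := herr.const_add 1
  rw [add_zero] at this
  refine this.congr' ?_
  filter_upwards [hev] with ε hε using (hmain ε hε).symm

lemma gradNormSq_nonneg {m : ℕ} (u : Euc m → ℂ) (y : Euc m) : 0 ≤ gradNormSq u y :=
  Finset.sum_nonneg fun _ _ => by positivity

lemma norm_fderiv_apply_sq_le_gradNormSq {m : ℕ} (u : Euc m → ℂ) (y : Euc m) {e : Euc m}
    (he : ‖e‖ = 1) : ‖fderiv ℝ u y e‖ ^ 2 ≤ gradNormSq u y := by
  have hsum : fderiv ℝ u y e = ∑ i, e i • pd u y i := by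
    have h := (EuclideanSpace.basisFun (Fin m) ℝ).sum_repr e
    conv_lhs => rw [← h]
    simp [map_sum, pd]
  have hle : ‖fderiv ℝ u y e‖ ≤ ∑ i, |e i| * ‖pd u y i‖ := by
    rw [hsum]
    refine (norm_sum_le _ _).trans_eq (Finset.sum_congr rfl fun i _ => ?_)
    rw [norm_smul, Real.norm_eq_abs]
  calc ‖fderiv ℝ u y e‖ ^ 2 ≤ (∑ i, |e i| * ‖pd u y i‖) ^ 2 := by gcongr
    _ ≤ (∑ i, |e i| ^ 2) * ∑ i, ‖pd u y i‖ ^ 2 := Finset.sum_mul_sq_le_sq_mul_sq _ _ _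
    _ = gradNormSq u y := by
      simp only [sq_abs]
      rw [← EuclideanSpace.real_norm_sq_eq, he, one_pow, one_mul, gradNormSq]

lemma integrableOn_norm_of_sq {α : Type*} [MeasurableSpace α] {μ : Measure α} {K : Set α}
    (hμ : μ K ≠ ⊤) {f : α → ℂ} (hf : IntegrableOn (fun y => ‖f y‖ ^ 2) K μ) :
    IntegrableOn (fun y => ‖f y‖) K μ := by
  have hm : AEStronglyMeasurable (fun y => ‖f y‖) (μ.restrict K) := by
    have := Real.continuous_sqrt.comp_aestronglyMeasurable hf.1
    simpa only [Function.comp_def, Real.sqrt_sq (norm_nonneg _)] using this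
  have : IsFiniteMeasure (μ.restrict K) := ⟨by simpa using hμ.lt_top⟩
  exact ((memLp_two_iff_integrable_sq hm).2 hf).integrable one_le_two

lemma sq_setIntegral_norm_le {α : Type*} [MeasurableSpace α] {μ : Measure α} {K : Set α}
    (hμ : μ K ≠ ⊤) {f : α → ℂ} (hf : IntegrableOn (fun y => ‖f y‖ ^ 2) K μ) :
    (∫ y in K, ‖f y‖ ∂μ) ^ 2 ≤ μ.real K * ∫ y in K, ‖f y‖ ^ 2 ∂μ := by
  have hf1 := integrableOn_norm_of_sq hμ hf
  have : IsFiniteMeasure (μ.restrict K) := ⟨by simpa using hμ.lt_top⟩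
  have h : ∀ a : ℝ, 0 ≤ μ.real K * (a * a) + (-2 * ∫ y in K, ‖f y‖ ∂μ) * a +
      ∫ y in K, ‖f y‖ ^ 2 ∂μ := fun a => by
    have h0 : 0 ≤ ∫ y in K, (a - ‖f y‖) ^ 2 ∂μ := integral_nonneg fun y => sq_nonneg _
    have e : ∀ y, (a - ‖f y‖) ^ 2 = (a * a + (-2 * a) * ‖f y‖) + ‖f y‖ ^ 2 := fun y => by ring
    have i1 : IntegrableOn (fun y => a * a + (-2 * a) * ‖f y‖) K μ :=
      (integrable_const _).add (hf1.const_mul _)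
    simp only [e] at h0
    rw [integral_add i1 hf, integral_add (integrable_const _) (hf1.const_mul _),
      integral_const, measureReal_restrict_apply_univ, smul_eq_mul, integral_const_mul] at h0
    linarith
  have := discrim_le_zero h
  rw [discrim] at this
  linarith

lemma sq_norm_integral_smul_le {α : Type*} [MeasurableSpace α] {μ : Measure α} {K : Set α}
    (hμ : μ K ≠ ⊤) {g : α → ℝ} {f : α → ℂ} {C : ℝ} (hg : ∀ y, |g y| ≤ C)
    (hg0 : ∀ y ∉ K, g y = 0) (hf : IntegrableOn (fun y => ‖f y‖ ^ 2) K μ) :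
    ‖∫ y, g y • f y ∂μ‖ ^ 2 ≤ C ^ 2 * μ.real K * ∫ y in K, ‖f y‖ ^ 2 ∂μ := by
  have h1 : ‖∫ y, g y • f y ∂μ‖ ≤ C * ∫ y in K, ‖f y‖ ∂μ := by
    rw [← setIntegral_eq_integral_of_forall_compl_eq_zero (s := K)
      fun y hy => by rw [hg0 y hy, zero_smul], ← integral_const_mul]
    refine norm_integral_le_of_norm_le ((integrableOn_norm_of_sq hμ hf).const_mul C)
      (Eventually.of_forall fun y => ?_)
    rw [norm_smul, Real.norm_eq_abs]
    exact mul_le_mul_of_nonneg_right (hg y) (norm_nonneg _)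
  calc _ ≤ (C * ∫ y in K, ‖f y‖ ∂μ) ^ 2 := by gcongr
    _ = C ^ 2 * (∫ y in K, ‖f y‖ ∂μ) ^ 2 := by ring
    _ ≤ C ^ 2 * (μ.real K * ∫ y in K, ‖f y‖ ^ 2 ∂μ) := by
      gcongr
      exact sq_setIntegral_norm_le hμ hf
    _ = _ := by ring

lemma MemH1.integrableOn_norm_fderiv_apply_sq {m : ℕ} {U : Set (Euc m)} {u : Euc m → ℂ}
    (hu : MemH1 U u) {e : Euc m} (he : ‖e‖ = 1) :
    IntegrableOn (fun y => ‖fderiv ℝ u y e‖ ^ 2) U := by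
  refine hu.2.2.mono' ?_ (Eventually.of_forall fun y => ?_)
  · exact ((measurable_fderiv_apply_const ℝ u e).norm.pow_const 2).aestronglyMeasurable
  · rw [Real.norm_of_nonneg (by positivity)]
    exact norm_fderiv_apply_sq_le_gradNormSq u y he

lemma MemH1.integral_mollBumpDeriv_smul {m : ℕ} {U : Set (Euc m)} (hU : IsOpen U)
    {u : Euc m → ℂ} (hu : MemH1 U u) {e : Euc m} (he : ‖e‖ = 1) {t : ℝ} (ht : 0 < t)
    {y₀ : Euc m} (hK : Metric.closedBall y₀ t ⊆ U) :
    ∫ y, mollBumpDeriv m t e y₀ y • u y = -∫ y, mollBump m t y₀ y • fderiv ℝ u y e := by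
  set K := Metric.closedBall y₀ t with hKdef
  have hKc : IsCompact K := isCompact_closedBall _ _
  have hcont : ContinuousOn u K := hu.1.continuousOn.mono hK
  have hout : ∀ {y}, y ∉ K → t < ‖y - y₀‖ := fun {y} hy => by
    rwa [hKdef, mem_closedBall_iff_norm, not_le] at hy
  have hsupp : ∀ {g : Euc m → ℝ} {f : Euc m → ℂ}, (∀ y ∉ K, g y = 0) →
      IntegrableOn (fun y => g y • f y) K → Integrable fun y => g y • f y := by
    intro g f hg h
    refine (integrableOn_iff_integrable_of_support_subset fun y hy => ?_).1 h
    by_contra hyK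
    exact hy (by simp [hg y hyK])
  have hT := fun y (hy : y ∉ K) => mollBump_eq_zero m ht (hout hy)
  have hT' := fun y (hy : y ∉ K) => mollBumpDeriv_eq_zero m ht e (hout hy)
  have hfd : IntegrableOn (fun y => fderiv ℝ u y e) K := by
    have h := (hu.integrableOn_norm_fderiv_apply_sq he).mono_set hK
    rw [IntegrableOn, ← integrable_norm_iff
      (measurable_fderiv_apply_const ℝ u e).aestronglyMeasurable]
    exact integrableOn_norm_of_sq hKc.measure_ne_top h
  refine integral_bilinear_hasLineDerivAt_right_eq_neg_left_of_integrable
    (B := (ContinuousLinearMap.lsmul ℝ ℝ : ℝ →L[ℝ] ℂ →L[ℝ] ℂ).flip)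
    (f' := fun y => fderiv ℝ u y e) (g := mollBump m t y₀) (v := e) ?_ ?_ ?_ ?_ ?_
  · exact hsupp hT (hfd.continuousOn_smul (continuous_mollBump m t y₀).continuousOn hKc)
  · exact hsupp hT' (((continuous_mollBumpDeriv m t e y₀).continuousOn.smul
      hcont).integrableOn_compact hKc)
  · exact hsupp hT (((continuous_mollBump m t y₀).continuousOn.smul
      hcont).integrableOn_compact hKc)
  · intro y hy
    have hyU := hK (tsupport_mollBump_subset m ht y₀ hy)
    exact (hu.1.differentiableAt (hU.mem_nhds hyU)).hasFDerivAt.hasLineDerivAt e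
  · exact fun y _ => hasLineDerivAt_mollBump m t e y₀ y

/-- A lower bound, along a needle sequence, for the energy on a ball away from the needle. -/
lemma IsNeedleSeq.eventually_sq_le {m : ℕ} (hm : m = 2 ∨ m = 3) {Ω : Set (Euc m)}
    (hΩ : IsOpen Ω) {k : ℝ} {G : Euc m → ℂ} (hG : IsFundSol k G) {x : Euc m} {σ : ℝ → Euc m}
    {v : ℕ → Euc m → ℂ} (hv : IsNeedleSeq Ω k G x σ v) {e : Euc m} (he : ‖e‖ = 1)
    {t : ℝ} (ht : 0 < t) {y₀ : Euc m}
    (hK : Metric.closedBall y₀ t ⊆ Ω \ (σ '' Icc 0 1)) {H A : ℝ}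
    (hH : ∀ s, |mollProfile m s| ≤ H) (hA0 : 0 ≤ A)
    (hA : A < ‖∫ y, mollBumpDeriv m t e y₀ y • G (y - x)‖) :
    ∀ᶠ n in atTop, A ^ 2 ≤ ((t ^ m)⁻¹ * H) ^ 2 * volume.real (Metric.closedBall y₀ t) *
      ∫ y in Metric.closedBall y₀ t, gradNormSq (v n) y := by
  set K := Metric.closedBall y₀ t with hKdef
  have hKc : IsCompact K := isCompact_closedBall _ _
  have hKΩ : K ⊆ Ω := fun y hy => (hK hy).1
  have hout : ∀ {y}, y ∉ K → t < ‖y - y₀‖ := fun {y} hy => by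
    rwa [hKdef, mem_closedBall_iff_norm, not_le] at hy
  obtain ⟨C, hC⟩ := (hasCompactSupport_mollBumpDeriv m ht e y₀).exists_bound_of_continuous
    (continuous_mollBumpDeriv m t e y₀)
  have hGx : MemLp (fun y => G (y - x)) 2 (volume.restrict K) := by
    have h := (hG.memLp_two hm (t + ‖y₀ - x‖))
    have hmp : MeasurePreserving (fun y : Euc m => y - x)
        (volume.restrict ((fun y => y - x) ⁻¹' Metric.closedBall (0 : Euc m) (t + ‖y₀ - x‖)))
        (volume.restrict (Metric.closedBall (0 : Euc m) (t + ‖y₀ - x‖))) :=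
      (measurePreserving_sub_right volume x).restrict_preimage measurableSet_closedBall
    refine (h.comp_measurePreserving hmp).mono_measure (Measure.restrict_mono ?_ le_rfl)
    intro y hy
    rw [hKdef, mem_closedBall_iff_norm] at hy
    rw [mem_preimage, mem_closedBall_zero_iff]
    calc ‖y - x‖ = ‖(y - y₀) + (y₀ - x)‖ := by congr 1; abel
      _ ≤ _ := (norm_add_le _ _).trans (by gcongr)
  have hvK : ∀ n, MemLp (v n) 2 (volume.restrict K) := fun n => by
    have h := (hv.1 n).1
    refine (memLp_two_iff_integrable_sq_norm ?_).2 (h.2.1.mono_set hKΩ)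
    exact (h.1.continuousOn.mono hKΩ).aestronglyMeasurable measurableSet_closedBall
  have hdiff : ∀ n, IntegrableOn (fun y => ‖v n y - G (y - x)‖ ^ 2) K := fun n =>
    (memLp_two_iff_integrable_sq_norm ((hvK n).sub hGx).1).1 ((hvK n).sub hGx)
  have hfin : IsFiniteMeasure (volume.restrict K) := ⟨by simpa using hKc.measure_lt_top⟩
  have hint : ∀ {f : Euc m → ℂ}, MemLp f 2 (volume.restrict K) →
      Integrable fun y => mollBumpDeriv m t e y₀ y • f y := fun {f} hf => by
    refine (integrableOn_iff_integrable_of_support_subset (s := K) fun y hy => ?_).1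
      (IntegrableOn.continuousOn_smul (hf.integrable one_le_two)
        (continuous_mollBumpDeriv m t e y₀).continuousOn hKc)
    by_contra hyK
    exact hy (by simp [mollBumpDeriv_eq_zero m ht e (hout hyK)])
  have hlim0 : Tendsto (fun n => ∫ y in K, ‖v n y - G (y - x)‖ ^ 2) atTop (𝓝 0) := by
    have h1 : Tendsto (fun n => √(∫ y in K, ‖v n y - G (y - x)‖ ^ 2)) atTop (𝓝 0) :=
      squeeze_zero (fun n => Real.sqrt_nonneg _)
        (fun n => le_add_of_nonneg_right (Real.sqrt_nonneg _)) (hv.2 K hKc hK)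
    have h2 := h1.pow 2
    rw [zero_pow two_ne_zero] at h2
    exact h2.congr fun n => Real.sq_sqrt (integral_nonneg fun y => by positivity)
  have hlim : Tendsto (fun n => ∫ y, mollBumpDeriv m t e y₀ y • v n y) atTop
      (𝓝 (∫ y, mollBumpDeriv m t e y₀ y • G (y - x))) := by
    rw [tendsto_iff_norm_sub_tendsto_zero]
    have hsq : Tendsto (fun n => ‖(∫ y, mollBumpDeriv m t e y₀ y • v n y) -
        ∫ y, mollBumpDeriv m t e y₀ y • G (y - x)‖ ^ 2) atTop (𝓝 0) := by
      refine squeeze_zero (fun n => by positivity) (fun n => ?_)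
        (by simpa using hlim0.const_mul (C ^ 2 * volume.real K))
      rw [← integral_sub (hint (hvK n)) (hint hGx)]
      simp only [← smul_sub]
      exact sq_norm_integral_smul_le hKc.measure_ne_top hC
        (fun y hy => mollBumpDeriv_eq_zero m ht e (hout hy)) (hdiff n)
    have := (Real.continuous_sqrt.tendsto 0).comp hsq
    rw [Real.sqrt_zero] at this
    exact this.congr fun n => Real.sqrt_sq (norm_nonneg _)
  filter_upwards [hlim.norm.eventually (lt_mem_nhds hA)] with n hn
  have hH1 := (hv.1 n).1
  rw [hH1.integral_mollBumpDeriv_smul hΩ he ht hKΩ, norm_neg] at hn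
  have hfd := (hH1.integrableOn_norm_fderiv_apply_sq he).mono_set hKΩ
  calc A ^ 2 ≤ ‖∫ y, mollBump m t y₀ y • fderiv ℝ (v n) y e‖ ^ 2 := by gcongr
    _ ≤ ((t ^ m)⁻¹ * H) ^ 2 * volume.real K * ∫ y in K, ‖fderiv ℝ (v n) y e‖ ^ 2 := by
      refine sq_norm_integral_smul_le hKc.measure_ne_top (fun y => ?_)
        (fun y hy => mollBump_eq_zero m ht (hout hy)) hfd
      rw [mollBump, abs_mul, abs_of_pos (by positivity)]
      gcongr
      exact hH _
    _ ≤ _ := by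
      gcongr ?_ * ?_
      exact setIntegral_mono hfd (hH1.2.2.mono_set hKΩ)
        fun y => norm_fderiv_apply_sq_le_gradNormSq _ y he

/-- On balls of radius `r * ε` around `x + ε • e` avoiding the needle, the energy of a needle
sequence is eventually bounded below, uniformly in `ε`. -/
lemma IsNeedleSeq.exists_eventually_le_setIntegral {m : ℕ} (hm : m = 2 ∨ m = 3)
    {Ω : Set (Euc m)} (hΩ : IsOpen Ω) {k : ℝ} {G : Euc m → ℂ} (hG : IsFundSol k G) {x : Euc m}
    {σ : ℝ → Euc m} {v : ℕ → Euc m → ℂ} (hv : IsNeedleSeq Ω k G x σ v) {e : Euc m}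
    (he : ‖e‖ = 1) {r : ℝ} (hr : 0 < r) (hr1 : r ≤ 1) :
    ∃ δ > 0, ∀ᶠ ε : ℝ in 𝓝[>] 0,
      Metric.closedBall (x + ε • e) (r * ε) ⊆ Ω \ (σ '' Icc 0 1) →
        ∀ᶠ n in atTop, δ ≤ ∫ y in Metric.closedBall (x + ε • e) (r * ε), gradNormSq (v n) y := by
  have hm2 : 2 ≤ m := by omega
  obtain ⟨H, hH0, hH, -⟩ := exists_mollProfile_le m
  set V := volume.real (Metric.closedBall (0 : Euc m) 1)
  have hV : 0 < V := ENNReal.toReal_pos (Metric.measure_closedBall_pos _ _ one_pos).ne'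
    (isCompact_closedBall _ _).measure_ne_top
  refine ⟨r ^ m / (4 * H ^ 2 * V), by positivity, ?_⟩
  have hlim := (hG.tendsto_integral_mollBumpDeriv hm2 he hr hr1).norm
  rw [norm_one] at hlim
  filter_upwards [hlim.eventually (lt_mem_nhds one_half_lt_one), Ioc_mem_nhdsGT one_pos]
    with ε hε hε01 hK
  have hε0 : 0 < ε := hε01.1
  have hA : (1 / 2) * (ε ^ (m - 1))⁻¹ <
      ‖∫ y, mollBumpDeriv m (r * ε) e (x + ε • e) y • G (y - x)‖ := by
    rw [← integral_add_right_eq_self _ x]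
    simp only [add_sub_cancel_right]
    have e1 : ∀ y, mollBumpDeriv m (r * ε) e (x + ε • e) (y + x) =
        mollBumpDeriv m (r * ε) e (ε • e) y := fun y => by
      simp only [mollBumpDeriv, add_comm y x, add_sub_add_left_eq_sub]
    simp only [e1]
    rw [norm_smul, Real.norm_of_nonneg (by positivity)] at hε
    rwa [mul_inv_lt_iff₀ (by positivity), mul_comm]
  filter_upwards [hv.eventually_sq_le hm hΩ hG he (mul_pos hr hε0) hK hH (by positivity) hA]
    with n hn
  rw [Measure.addHaar_real_closedBall' _ _ (by positivity), finrank_euclideanSpace_fin] at hn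
  set I := ∫ y in Metric.closedBall (x + ε • e) (r * ε), gradNormSq (v n) y
  obtain ⟨j, rfl⟩ : ∃ j, m = j + 2 := ⟨m - 2, by omega⟩
  have e2 : ((1 / 2) * (ε ^ (j + 2 - 1))⁻¹) ^ 2 = 1 / (4 * ε ^ j * ε ^ (j + 2)) := by
    rw [show j + 2 - 1 = j + 1 by omega]
    field_simp
    ring
  have e3 : (((r * ε) ^ (j + 2))⁻¹ * H) ^ 2 * ((r * ε) ^ (j + 2) * V) * I =
      H ^ 2 * V * I / (r ^ (j + 2) * ε ^ (j + 2)) := by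
    rw [mul_pow r ε]
    field_simp
  rw [e2, e3, div_le_div_iff₀ (by positivity) (by positivity)] at hn
  have hn' : r ^ (j + 2) ≤ H ^ 2 * V * I * (4 * ε ^ j) := by
    refine le_of_mul_le_mul_right ?_ (pow_pos hε0 (j + 2))
    linarith
  have hI : 0 ≤ I := integral_nonneg fun y => gradNormSq_nonneg _ y
  have hεj : ε ^ j ≤ 1 := pow_le_one₀ hε0.le hε01.2
  rw [div_le_iff₀ (by positivity)]
  calc r ^ (j + 2) ≤ H ^ 2 * V * I * (4 * ε ^ j) := hn'
    _ ≤ H ^ 2 * V * I * (4 * 1) := by gcongr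
    _ = _ := by ring

lemma Monotone.exists_mem_Icc_castSucc_succ {M : ℕ} {t : Fin (M + 2) → ℝ} (ht : Monotone t)
    {s : ℝ} (h0 : t 0 ≤ s) (h1 : s ≤ t (Fin.last (M + 1))) :
    ∃ i : Fin (M + 1), s ∈ Icc (t i.castSucc) (t i.succ) := by
  have key : ∀ j : Fin (M + 2), s ≤ t j → s ≤ t 0 ∨
      ∃ i : Fin (M + 1), s ∈ Icc (t i.castSucc) (t i.succ) := by
    intro j
    induction j using Fin.induction with
    | zero => exact Or.inl
    | succ i ih =>
      intro h
      rcases le_total s (t i.castSucc) with hs | hs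
      · exact ih hs
      · exact Or.inr ⟨i, hs, h⟩
  exact (key _ h1).elim (fun h => ⟨0, h0, h.trans (ht (Fin.zero_le _))⟩) id

/-- Near its tip, a needle is contained in a line through the tip. -/
lemma IsNeedle.exists_mem_span {m : ℕ} {Ω : Set (Euc m)} {x : Euc m} {σ : ℝ → Euc m}
    (hσ : IsNeedle Ω x σ) :
    ∃ d : Euc m, ∃ η > 0, ∀ y ∈ σ '' Icc 0 1, ‖y - x‖ < η → y - x ∈ Submodule.span ℝ {d} := by
  obtain ⟨-, hx, -, hinj, M, t, ht, ht0, ht1, hlin⟩ := hσ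
  obtain _ | M := M
  · exact absurd (ht0.symm.trans ht1) zero_ne_one
  set S : Set (Euc m) := ⋃ i ∈ {i : Fin (M + 1) | i ≠ Fin.last M},
    σ '' Icc (t i.castSucc) (t i.succ) with hS
  have hSc : IsClosed S := by
    refine IsCompact.isClosed ((Set.toFinite _).isCompact_biUnion fun i _ => ?_)
    refine isCompact_Icc.image_of_continuousOn (ContinuousOn.congr ?_ (hlin i))
    fun_prop
  have hxS : x ∉ S := by
    simp only [hS, mem_iUnion, mem_image, not_exists, not_and]
    intro i hi s hs hsx
    have hlt : t i.succ < 1 := by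
      rw [← ht1]
      refine ht (Fin.lt_last_iff_ne_last.2 fun h => hi ?_)
      rwa [← Fin.succ_last, Fin.succ_inj] at h
    have h0 : 0 ≤ s := by
      rw [← ht0]
      exact (ht.monotone (Fin.zero_le _)).trans hs.1
    have := hinj ⟨h0, (hs.2.trans_lt hlt).le⟩ ⟨zero_le_one, le_rfl⟩ (hsx.trans hx.symm)
    linarith [hs.2]
  obtain ⟨η, hη, hball⟩ := Metric.isOpen_iff.1 hSc.isOpen_compl x hxS
  refine ⟨σ (t (Fin.last M).castSucc) - x, η, hη, ?_⟩
  rintro _ ⟨s, hs, rfl⟩ hsη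
  obtain ⟨i, hi⟩ := ht.monotone.exists_mem_Icc_castSucc_succ (ht0.trans_le hs.1)
    (hs.2.trans_eq ht1.symm)
  have hil : i = Fin.last M := by
    by_contra h
    exact hball (mem_ball_iff_norm.2 hsη) (mem_biUnion (show i ∈ {i | i ≠ Fin.last M} from h)
      (mem_image_of_mem σ hi))
  subst hil
  rw [hlin _ s hi, Fin.succ_last, ht1, hx]
  set c := (s - t (Fin.last M).castSucc) / (1 - t (Fin.last M).castSucc)
  rw [Submodule.mem_span_singleton]
  exact ⟨1 - c, by module⟩

/-- An open cone of directions is not contained in a line. -/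
lemma exists_closedBall_subset_cone {m : ℕ} (hm : 2 ≤ m) {b : Euc m} (hb : b ≠ 0) {θ : ℝ}
    (hθ : θ ∈ Ioo 0 Real.pi) (d : Euc m) :
    ∃ e : Euc m, ‖e‖ = 1 ∧ ∃ r > 0, r ≤ 1 / 4 ∧ ∀ w ∈ Metric.closedBall e r,
      ‖w‖ * ‖b‖ * Real.cos (θ / 2) < ⟪w, b⟫ ∧ w ∉ Submodule.span ℝ {d} := by
  set C : Set (Euc m) := {w | ‖w‖ * ‖b‖ * Real.cos (θ / 2) < ⟪w, b⟫}
  have hC : IsOpen C := isOpen_lt (by fun_prop) (by fun_prop)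
  have hbC : b ∈ C := by
    have hcos : Real.cos (θ / 2) < 1 := by
      rw [← Real.cos_zero]
      exact Real.cos_lt_cos_of_nonneg_of_le_pi_div_two le_rfl (by linarith [hθ.2])
        (by linarith [hθ.1])
    have hb' : 0 < ‖b‖ := norm_pos_iff.2 hb
    change ‖b‖ * ‖b‖ * Real.cos (θ / 2) < ⟪b, b⟫
    rw [real_inner_self_eq_norm_mul_norm]
    exact mul_lt_of_lt_one_right (by positivity) hcos
  have hspan : Submodule.span ℝ {d} ≠ ⊤ := fun h => by
    have h1 := finrank_span_le_card (R := ℝ) ({d} : Set (Euc m))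
    rw [h, finrank_top, finrank_euclideanSpace_fin] at h1
    rw [toFinset_singleton, Finset.card_singleton] at h1
    omega
  obtain ⟨z, hzC, hz⟩ : ∃ z ∈ C, z ∉ Submodule.span ℝ {d} := by
    by_contra! h
    have hpos := hC.measure_pos volume ⟨b, hbC⟩
    exact hpos.ne' (measure_mono_null h (Measure.addHaar_submodule volume _ hspan))
  have hz0 : z ≠ 0 := fun h => hz (h ▸ Submodule.zero_mem _)
  have hz0' : 0 < ‖z‖ := norm_pos_iff.2 hz0
  have hopen : IsOpen (C \ (Submodule.span ℝ {d} : Set (Euc m))) :=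
    hC.sdiff (Submodule.closed_of_finiteDimensional _)
  have he : ‖z‖⁻¹ • z ∈ C \ (Submodule.span ℝ {d} : Set (Euc m)) := by
    refine ⟨?_, fun h => hz ?_⟩
    · change ‖‖z‖⁻¹ • z‖ * ‖b‖ * Real.cos (θ / 2) < ⟪‖z‖⁻¹ • z, b⟫
      rw [norm_smul, real_inner_smul_left, norm_inv, norm_norm, mul_assoc, mul_assoc]
      exact mul_lt_mul_of_pos_left (by rw [← mul_assoc]; exact hzC) (by positivity)
    · have := Submodule.smul_mem _ ‖z‖ h
      rwa [smul_inv_smul₀ hz0'.ne'] at this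
  obtain ⟨r, hr, hball⟩ := Metric.nhds_basis_closedBall.mem_iff.1 (hopen.mem_nhds he)
  refine ⟨‖z‖⁻¹ • z, norm_smul_inv_norm hz0, min r (1 / 4), by positivity, min_le_right _ _,
    fun w hw => ?_⟩
  exact hball (Metric.closedBall_subset_closedBall (min_le_left _ _) hw)

lemma IsNeedle.exists_eventually_closedBall_subset {m : ℕ} (hm : 2 ≤ m) {Ω : Set (Euc m)}
    (hΩ : IsOpen Ω) {x : Euc m} (hx : x ∈ Ω) {σ : ℝ → Euc m} (hσ : IsNeedle Ω x σ)
    {b : Euc m} (hb : b ≠ 0) {ρ θ : ℝ} (hρ : 0 < ρ) (hθ : θ ∈ Ioo 0 Real.pi) :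
    ∃ e : Euc m, ‖e‖ = 1 ∧ ∃ r > 0, r ≤ 1 / 4 ∧ ∀ᶠ ε : ℝ in 𝓝[>] 0,
      Metric.closedBall (x + ε • e) (r * ε) ⊆ finiteCone x b ρ θ ∩ (Ω \ (σ '' Icc 0 1)) := by
  obtain ⟨d, η, hη, hspan⟩ := hσ.exists_mem_span
  obtain ⟨e, he, r, hr, hr4, hcone⟩ := exists_closedBall_subset_cone hm hb hθ d
  obtain ⟨R, hR, hball⟩ := Metric.isOpen_iff.1 hΩ x hx
  refine ⟨e, he, r, hr, hr4, ?_⟩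
  have hmin : 0 < min ρ (min η R) / 2 := by positivity
  filter_upwards [Ioo_mem_nhdsGT hmin] with ε hε y hy
  have hε0 : 0 < ε := hε.1
  obtain ⟨w, rfl⟩ : ∃ w, y = x + ε • w :=
    ⟨ε⁻¹ • (y - x), by rw [smul_inv_smul₀ hε0.ne']; abel⟩
  have hw : w ∈ Metric.closedBall e r := by
    rw [mem_closedBall_iff_norm, add_sub_add_left_eq_sub, ← smul_sub, norm_smul,
      Real.norm_of_nonneg hε0.le, mul_comm] at hy
    rw [mem_closedBall_iff_norm]
    exact le_of_mul_le_mul_right hy hε0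
  obtain ⟨hwC, hwd⟩ := hcone w hw
  have hw2 : ‖w‖ ≤ 2 := by
    rw [mem_closedBall_iff_norm] at hw
    linarith [norm_le_norm_add_norm_sub' w e]
  have hnorm : ‖x + ε • w - x‖ < min ρ (min η R) := by
    rw [add_sub_cancel_left, norm_smul, Real.norm_of_nonneg hε0.le]
    nlinarith [hε.2]
  rw [lt_min_iff, lt_min_iff] at hnorm
  refine ⟨⟨hnorm.1, ?_⟩, hball (mem_ball_iff_norm.2 hnorm.2.2), fun h => hwd ?_⟩
  · rw [add_sub_cancel_left, norm_smul, real_inner_smul_left, Real.norm_of_nonneg hε0.le,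
      mul_assoc, mul_assoc, ← mul_assoc ‖w‖]
    exact mul_lt_mul_of_pos_left hwC hε0
  · have h' := Submodule.smul_mem _ ε⁻¹ (hspan _ h hnorm.2.1)
    rwa [add_sub_cancel_left, inv_smul_smul₀ hε0.ne'] at h'

lemma disjoint_closedBall_dyadic {E : Type*} [NormedAddCommGroup E] [NormedSpace ℝ E] (x : E)
    {e : E} (he : ‖e‖ = 1) {r ε : ℝ} (hr : 0 < r) (hr4 : r ≤ 1 / 4) (hε : 0 < ε) {i j : ℕ}
    (hij : i ≠ j) :
    Disjoint (Metric.closedBall (x + (ε / 2 ^ i) • e) (r * (ε / 2 ^ i)))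
      (Metric.closedBall (x + (ε / 2 ^ j) • e) (r * (ε / 2 ^ j))) := by
  wlog h : i < j generalizing i j
  · exact (this hij.symm (lt_of_le_of_ne (not_lt.1 h) hij.symm)).symm
  refine Metric.closedBall_disjoint_closedBall ?_
  have hj : ε / 2 ^ j ≤ ε / 2 ^ i / 2 := by
    rw [div_div, ← pow_succ]
    gcongr
    · norm_num
    · omega
  have hi : 0 < ε / 2 ^ i := by positivity
  have hj0 : 0 < ε / 2 ^ j := by positivity
  rw [dist_eq_norm, add_sub_add_left_eq_sub, ← sub_smul, norm_smul, he, mul_one,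
    Real.norm_of_nonneg (by linarith)]
  nlinarith

/-- Lemma 2.5: for any point `x ∈ Ω`, any needle `σ` with tip at `x`,
any needle sequence `{v_n}` for `(x, σ)` and any finite cone `V` with vertex at `x`,
`∫_{V ∩ Ω} |∇v_n|² dy → ∞`. -/
theorem statement_8 {m : ℕ} (hm : m = 2 ∨ m = 3) (Ω : Set (Euc m)) (hΩo : IsOpen Ω)
    (hΩc : IsConnected Ω) (hΩb : Bornology.IsBounded Ω) (hΩl : HasLipschitzBoundary Ω)
    (k : ℝ) (hk : 0 ≤ k) (G : Euc m → ℂ) (hG : IsFundSol k G)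
    (x : Euc m) (hx : x ∈ Ω) (σ : ℝ → Euc m) (hσ : IsNeedle Ω x σ)
    (v : ℕ → Euc m → ℂ) (hv : IsNeedleSeq Ω k G x σ v)
    (b : Euc m) (hb : b ≠ 0) (ρ θ : ℝ) (hρ : 0 < ρ) (hθ : θ ∈ Set.Ioo 0 Real.pi) :
    Filter.Tendsto (fun n => ∫ y in finiteCone x b ρ θ ∩ Ω, gradNormSq (v n) y)
      Filter.atTop Filter.atTop := by
  have hm2 : 2 ≤ m := by omega
  obtain ⟨e, he, r, hr, hr4, hsub⟩ :=
    hσ.exists_eventually_closedBall_subset hm2 hΩo hx hb hρ hθ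
  obtain ⟨δ, hδ, hlow⟩ :=
    hv.exists_eventually_le_setIntegral hm hΩo hG he hr (hr4.trans (by norm_num))
  obtain ⟨ε, hε, hball⟩ := mem_nhdsGT_iff_exists_Ioc_subset.1 (hsub.and hlow)
  have hε0 : (0 : ℝ) < ε := hε
  set K : ℕ → Set (Euc m) := fun j =>
    Metric.closedBall (x + (ε / 2 ^ j) • e) (r * (ε / 2 ^ j))
  have hmem : ∀ j : ℕ, ε / 2 ^ j ∈ Ioc 0 ε := fun j =>
    ⟨by positivity, div_le_self hε0.le (one_le_pow₀ one_le_two)⟩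
  have hK : ∀ j, K j ⊆ finiteCone x b ρ θ ∩ (Ω \ (σ '' Icc 0 1)) := fun j =>
    (hball (hmem j)).1
  have hKΩ : ∀ j, K j ⊆ finiteCone x b ρ θ ∩ Ω := fun j y hy => ⟨(hK j hy).1, (hK j hy).2.1⟩
  refine tendsto_atTop.2 fun B => ?_
  obtain ⟨N, hN⟩ := exists_nat_ge (B / δ)
  have hev : ∀ᶠ n in atTop, ∀ j ∈ Finset.range N, δ ≤ ∫ y in K j, gradNormSq (v n) y :=
    (eventually_all_finset _).2 fun j _ => (hball (hmem j)).2 fun y hy => (hK j hy).2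
  filter_upwards [hev] with n hn
  have hint : IntegrableOn (fun y => gradNormSq (v n) y) (finiteCone x b ρ θ ∩ Ω) :=
    (hv.1 n).1.2.2.mono_set inter_subset_right
  calc B ≤ N * δ := (div_le_iff₀ hδ).1 hN
    _ = ∑ j ∈ Finset.range N, δ := by simp
    _ ≤ ∑ j ∈ Finset.range N, ∫ y in K j, gradNormSq (v n) y := Finset.sum_le_sum hn
    _ = ∫ y in ⋃ j ∈ Finset.range N, K j, gradNormSq (v n) y :=
      (integral_biUnion_finset _ (fun j _ => measurableSet_closedBall)
        (fun i _ j _ hij => disjoint_closedBall_dyadic x he hr hr4 hε0 hij)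
        fun j _ => hint.mono_set (hKΩ j)).symm
    _ ≤ _ := setIntegral_mono_set hint (Eventually.of_forall fun y => gradNormSq_nonneg _ y)
      (iUnion₂_subset fun j _ => hKΩ j).eventuallyLE
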